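/- arXiv:0809.0180 — 2 statements merged into one kernel-verified Lean document; each statement's English description precedes it below -/
import Mathlib

section
/- Let m ≥ 0 and n be integers, a ∈ fil_n W_{m+1}(K), α = α(a), and let b, c ∈ K be nonzero with b' ≠ 0 and c' ≠ 0; set ν(b) = ord(t·b'/b) and ν(c) = ord(t·c'/c). Assume α + c·b' = 0 and ν(b) + ν(c) < (p−2)·r. Set E = W_{m+1}(u)(a) − W_{m+1}(v)(a) + V^m( v(c)·(u(b) − v(b)) ) ∈ W_{m+1}(L). Then E ∈ fil_{n−ν(c)−2r} W_{m+1}(L), and moreover E − V^m( v((1/2)·t²·α·c'/c)·t^{2r}·θ² ) ∈ fil_{n−ν(c)−2r−1} W_{m+1}(L). -/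
/-!
Setting: `p > 2` a prime, `k` a perfect field of characteristic `p`,
`K = k((t))` the field of formal Laurent series, `ord` the `t`-adic valuation
(with `ord 0 = +∞`, encoded below via the predicate `ordGe`),
`L = k(θ)((t))` with `k(θ) = RatFunc k`.
-/

noncomputable section

namespace LFT

variable {F : Type*} [Field F]

/-- The formal derivative of a Laurent series: the coefficient of `t^j` in `lsDeriv x`
is `(j+1)` times the coefficient of `t^{j+1}` in `x`. -/
def lsDeriv (x : LaurentSeries F) : LaurentSeries F where
  coeff j := (j + 1) • x.coeff (j + 1)
  isPWO_support' := by
    have h : Function.support (fun j : ℤ => (j + 1) • x.coeff (j + 1)) ⊆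
        (fun j : ℤ => j - 1) '' Function.support x.coeff := by
      intro j hj
      refine ⟨j + 1, ?_, by ring⟩
      intro h0
      simp [Function.mem_support, h0] at hj
    exact (x.isPWO_support'.image_of_monotone (fun a b hab => by omega)).mono h

/-- The uniformizer `t` of `F((t))`. -/
def tt : LaurentSeries F := HahnSeries.single 1 1

/-- `ordGe x N` means `ord x ≥ N`, with the convention `ord 0 = +∞`. -/
def ordGe (x : LaurentSeries F) (N : ℤ) : Prop := x = 0 ∨ N ≤ x.order

/-- The element `θ` of `k(θ) ⊆ k(θ)((t))`. -/
def θθ (k : Type*) [Field k] : LaurentSeries (RatFunc k) := HahnSeries.single 0 RatFunc.X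

/-- Membership in the level `N` of the Kato filtration `fil_N W_{m+1}(F((t)))`:
`p^{m-i}·ord(a_i) ≥ -N` for all `0 ≤ i ≤ m` (with `ord 0 = +∞`). -/
def inFil (p : ℕ) {m : ℕ} (N : ℤ) (a : TruncatedWittVector p (m + 1) (LaurentSeries F)) : Prop :=
  ∀ i : Fin (m + 1), a.coeff i = 0 ∨ -N ≤ (p : ℤ) ^ (m - (i : ℕ)) * (a.coeff i).order

/-- `α(a) = Σ_{i=0}^m a_i^{p^{m-i}-1}·a_i'`, so that `F^m d(a) = α(a)·dt`. -/
def alphaW (p : ℕ) {m : ℕ} (a : TruncatedWittVector p (m + 1) (LaurentSeries F)) :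
    LaurentSeries F :=
  ∑ i : Fin (m + 1), a.coeff i ^ (p ^ (m - (i : ℕ)) - 1) * lsDeriv (a.coeff i)

/-- The componentwise map `W_{m+1}(f)` on truncated Witt vectors induced by `f`. -/
def mapTW (p : ℕ) {m : ℕ} {K L : Type*} (f : K → L)
    (a : TruncatedWittVector p (m + 1) K) : TruncatedWittVector p (m + 1) L :=
  TruncatedWittVector.mk p fun i => f (a.coeff i)

/-- `V^m(z) = (0, …, 0, z)` in `W_{m+1}(L)`. -/
def Vm (p : ℕ) {m : ℕ} {L : Type*} [Zero L] (z : L) : TruncatedWittVector p (m + 1) L :=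
  TruncatedWittVector.mk p fun i => if (i : ℕ) = m then z else 0


section basics

theorem ordGe_iff {x : LaurentSeries F} {N : ℤ} : ordGe x N ↔ ∀ j < N, x.coeff j = 0 := by
  unfold ordGe
  by_cases hx : x = 0
  · simp [hx]
  · rw [HahnSeries.le_order_iff_forall hx]
    simp [hx]

theorem ordGe_zero (N : ℤ) : ordGe (0 : LaurentSeries F) N := Or.inl rfl

theorem ordGe.mono {x : LaurentSeries F} {N M : ℤ} (h : ordGe x N) (hM : M ≤ N) : ordGe x M :=
  h.imp id fun h => hM.trans h

theorem ordGe.add {x y : LaurentSeries F} {N : ℤ} (hx : ordGe x N) (hy : ordGe y N) :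
    ordGe (x + y) N := by
  rw [ordGe_iff] at *
  intro j hj
  simp [hx j hj, hy j hj]

theorem ordGe.neg {x : LaurentSeries F} {N : ℤ} (hx : ordGe x N) : ordGe (-x) N := by
  rw [ordGe_iff] at *
  intro j hj
  simp [hx j hj]

theorem ordGe.sub {x y : LaurentSeries F} {N : ℤ} (hx : ordGe x N) (hy : ordGe y N) :
    ordGe (x - y) N := by
  rw [sub_eq_add_neg]; exact hx.add hy.neg

theorem ordGe.sum {ι : Type*} {s : Finset ι} {f : ι → LaurentSeries F} {N : ℤ}
    (h : ∀ i ∈ s, ordGe (f i) N) : ordGe (∑ i ∈ s, f i) N := by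
  classical
  induction s using Finset.induction_on with
  | empty => simpa using ordGe_zero N
  | insert a s ha ih =>
    rw [Finset.sum_insert ha]
    exact (h a (by simp)).add (ih fun i hi => h i (by simp [hi]))

theorem ordGe.mul {x y : LaurentSeries F} {N M : ℤ} (hx : ordGe x N) (hy : ordGe y M) :
    ordGe (x * y) (N + M) := by
  rcases hx with rfl | hx
  · left; simp
  rcases hy with rfl | hy
  · left; simp
  by_cases hx0 : x = 0
  · left; simp [hx0]
  by_cases hy0 : y = 0
  · left; simp [hy0]
  right
  rw [HahnSeries.order_mul hx0 hy0]; omega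

theorem ordGe.mul' {x y : LaurentSeries F} {N M T : ℤ} (hx : ordGe x N) (hy : ordGe y M)
    (h : T ≤ N + M) : ordGe (x * y) T := (hx.mul hy).mono h

theorem ordGe_one : ordGe (1 : LaurentSeries F) 0 := by
  right; simp

theorem ordGe.pow {x : LaurentSeries F} {N : ℤ} (hx : ordGe x N) (n : ℕ) :
    ordGe (x ^ n) (n * N) := by
  induction n with
  | zero => simpa using ordGe_one
  | succ n ih => rw [pow_succ]; exact ih.mul' hx (by push_cast; linarith)

theorem ordGe_single (j : ℤ) (c : F) : ordGe (HahnSeries.single j c : LaurentSeries F) j := by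
  rw [ordGe_iff]
  intro i hi
  rw [HahnSeries.coeff_single_of_ne hi.ne]

theorem ordGe_natCast (n : ℕ) : ordGe (n : LaurentSeries F) 0 := by
  induction n with
  | zero => simpa using ordGe_zero 0
  | succ n ih => push_cast; exact ih.add ordGe_one

theorem ordGe_self (x : LaurentSeries F) : ordGe x x.order := Or.inr le_rfl

theorem order_inv' {x : LaurentSeries F} (hx : x ≠ 0) : (x⁻¹).order = - x.order := by
  have h := HahnSeries.order_mul hx (inv_ne_zero hx)
  rw [mul_inv_cancel₀ hx, HahnSeries.order_one] at h
  omega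

theorem ordGe.inv_natCast (n : ℕ) : ordGe ((n : LaurentSeries F)⁻¹) 0 := by
  by_cases h : (n : LaurentSeries F) = 0
  · rw [h]; simpa using ordGe_zero 0
  right
  rw [order_inv' h]
  have : (n : LaurentSeries F) = HahnSeries.C (n : F) := by simp
  rw [this, HahnSeries.order_C]; simp

theorem tt_ne : (tt : LaurentSeries F) ≠ 0 := by
  unfold tt; simp

theorem order_tt : (tt : LaurentSeries F).order = 1 := by
  unfold tt; rw [HahnSeries.order_single one_ne_zero]

theorem ordGe_tt : ordGe (tt : LaurentSeries F) 1 := ordGe_single 1 1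

theorem order_zpow' {x : LaurentSeries F} (hx : x ≠ 0) (n : ℤ) : (x ^ n).order = n * x.order := by
  rcases n with n | n
  · simp
  · rw [zpow_negSucc, order_inv' (pow_ne_zero _ hx), HahnSeries.order_pow]
    simp; push_cast [Int.negSucc_eq]; ring

theorem order_tt_zpow (n : ℤ) : ((tt : LaurentSeries F) ^ n).order = n := by
  rw [order_zpow' tt_ne, order_tt, mul_one]

theorem ordGe_tt_zpow (n : ℤ) : ordGe ((tt : LaurentSeries F) ^ n) n :=
  Or.inr (order_tt_zpow n).ge

theorem ordGe_lsDeriv {x : LaurentSeries F} {N : ℤ} (h : ordGe x N) : ordGe (lsDeriv x) (N - 1) := by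
  rw [ordGe_iff] at *
  intro j hj
  simp [lsDeriv, h (j + 1) (by omega)]

theorem coeff_tt_mul_lsDeriv (x : LaurentSeries F) (j : ℤ) :
    (tt * lsDeriv x).coeff j = j • x.coeff j := by
  unfold tt
  rw [HahnSeries.coeff_single_mul]
  simp [lsDeriv]

theorem lsDeriv_add (x y : LaurentSeries F) : lsDeriv (x + y) = lsDeriv x + lsDeriv y := by
  ext j; simp [lsDeriv]

theorem tt_mul_lsDeriv_mul (x y : LaurentSeries F) :
    tt * lsDeriv (x * y) = (tt * lsDeriv x) * y + x * (tt * lsDeriv y) := by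
  have hs (z : LaurentSeries F) : (tt * lsDeriv z).support ⊆ z.support := by
    intro j hj h0
    apply hj
    rw [coeff_tt_mul_lsDeriv, h0, smul_zero]
  ext j
  rw [coeff_tt_mul_lsDeriv, HahnSeries.coeff_add,
    HahnSeries.coeff_mul_left' x.isPWO_support (hs x),
    HahnSeries.coeff_mul_right' y.isPWO_support (hs y), HahnSeries.coeff_mul,
    ← Finset.sum_add_distrib, Finset.smul_sum]
  refine Finset.sum_congr rfl fun ij hij => ?_
  rw [coeff_tt_mul_lsDeriv, coeff_tt_mul_lsDeriv]
  have : ij.1 + ij.2 = j := by simp at hij; exact hij.2.2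
  rw [← this]
  simp only [zsmul_eq_mul]; push_cast; ring

theorem lsDeriv_mul (x y : LaurentSeries F) :
    lsDeriv (x * y) = x * lsDeriv y + y * lsDeriv x := by
  apply mul_left_cancel₀ (tt_ne (F := F))
  rw [tt_mul_lsDeriv_mul]; ring

/-- Build a derivation of a field from its additivity and Leibniz rule. -/
def mkDer {K : Type*} [Field K] (f : K → K) (hadd : ∀ x y, f (x + y) = f x + f y)
    (hmul : ∀ x y, f (x * y) = x * f y + y * f x) : Derivation ℤ K K where
  toFun := f
  map_add' := hadd
  map_smul' n x := map_zsmul (AddMonoidHom.mk' f hadd) n x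
  map_one_eq_zero' := by
    have h : f 1 = 0 := by simpa using hmul 1 1
    exact h
  leibniz' x y := hmul x y

/-- The derivation `d/dt`. -/
def DD := mkDer (K := LaurentSeries F) lsDeriv lsDeriv_add lsDeriv_mul

theorem DD_apply (x : LaurentSeries F) : DD x = lsDeriv x := rfl

theorem DD_tt : DD (tt : LaurentSeries F) = 1 := by
  ext j
  rw [DD_apply]
  simp only [lsDeriv, tt, HahnSeries.coeff_single, HahnSeries.coeff_one]
  by_cases h : j = 0
  · simp [h]
  · simp [h]

theorem DD_single_zero (c : F) : DD (HahnSeries.single 0 c : LaurentSeries F) = 0 := by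
  ext j
  rw [DD_apply]
  simp only [lsDeriv, HahnSeries.coeff_single]
  by_cases h : j = -1
  · simp [h]
  · have : j + 1 ≠ 0 := by omega
    simp [this]

theorem ordGe_DD_iter {x : LaurentSeries F} {N : ℤ} (h : ordGe x N) (i : ℕ) :
    ordGe (DD^[i] x) (N - i) := by
  induction i with
  | zero => simpa using h
  | succ i ih =>
    rw [Function.iterate_succ_apply']
    exact (ordGe_lsDeriv ih).mono (by push_cast; omega)

end basics

section wittpoly

open Polynomial

variable (p : ℕ) [hpF : Fact p.Prime]

/-- `[1+X] - [1]` in the Witt vectors of `ℤ[X]`. -/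
def ww : WittVector p ℤ[X] := WittVector.teichmuller p (1 + X) - WittVector.teichmuller p 1

/-- The components of `[1+X] - [1]`. -/
def ss (l : ℕ) : ℤ[X] := (ww p).coeff l

theorem coeff_teich_sub {A : Type*} [CommRing A] (z : A) (j : ℕ) :
    (WittVector.teichmuller p (1 + z) - WittVector.teichmuller p 1).coeff j =
      eval₂ (Int.castRingHom A) z (ss p j) := by
  have h : WittVector.map (eval₂RingHom (Int.castRingHom A) z) (ww p) =
      WittVector.teichmuller p (1 + z) - WittVector.teichmuller p 1 := by
    unfold ww
    rw [map_sub, WittVector.map_teichmuller, WittVector.map_teichmuller]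
    simp
  rw [← h, WittVector.map_coeff]
  rfl

theorem ss_dvd (l : ℕ) : X ∣ ss p l := by
  rw [X_dvd_iff]
  have := coeff_teich_sub p (0 : ℤ) l
  rw [add_zero, sub_self, WittVector.zero_coeff] at this
  simpa using this.symm

theorem ss_ghost (l : ℕ) :
    ∑ i ∈ Finset.range (l + 1), (p : ℤ[X]) ^ i * ss p i ^ (p ^ (l - i)) = (1 + X) ^ (p ^ l) - 1 := by
  have h : WittVector.ghostComponent l (ww p) = (1 + X) ^ (p ^ l) - 1 := by
    unfold ww
    rw [map_sub, WittVector.ghostComponent_teichmuller, WittVector.ghostComponent_teichmuller]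
    simp
  rw [← h, WittVector.ghostComponent_apply, wittPolynomial_eq_sum_C_mul_X_pow]
  simp [ss]

theorem ss_deriv (l : ℕ) : X ^ (p - 1) ∣ derivative (ss p l) - (1 + X) ^ (p ^ l - 1) := by
  have h := congrArg derivative (ss_ghost p l)
  rw [Finset.sum_range_succ, derivative_add, derivative_sum] at h
  have hp0 : ((p : ℤ[X]) ^ l) ≠ 0 := pow_ne_zero _ (by exact_mod_cast hpF.out.ne_zero)
  have h1 : ∀ i ∈ Finset.range l, derivative ((p : ℤ[X]) ^ i * ss p i ^ (p ^ (l - i))) =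
      (p : ℤ[X]) ^ l * (ss p i ^ (p ^ (l - i) - 1) * derivative (ss p i)) := by
    intro i hi
    have hi' : i < l := by simpa using hi
    have : (p : ℤ[X]) ^ l = p ^ i * p ^ (l - i) := by rw [← pow_add]; congr 1; omega
    rw [this]
    have hd : derivative ((p : ℤ[X]) ^ i) = 0 := by
      rw [← Nat.cast_pow]; simp
    simp only [derivative_mul, hd, derivative_pow]
    push_cast
    simp
    ring
  rw [Finset.sum_congr rfl h1, ← Finset.mul_sum] at h
  have hd : derivative ((p : ℤ[X]) ^ l) = 0 := by
    rw [← Nat.cast_pow]; simp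
  have h2 : (p : ℤ[X]) ^ l * (∑ i ∈ Finset.range l, ss p i ^ (p ^ (l - i) - 1) * derivative (ss p i)
      + derivative (ss p l)) = (p : ℤ[X]) ^ l * ((1 + X) ^ (p ^ l - 1)) := by
    simp only [derivative_mul, hd, derivative_pow, derivative_sub, derivative_add, derivative_X,
      derivative_one] at h
    simp at h
    linear_combination h
  have h3 := mul_left_cancel₀ hp0 h2
  have h4 : derivative (ss p l) - (1 + X) ^ (p ^ l - 1) =
      - ∑ i ∈ Finset.range l, ss p i ^ (p ^ (l - i) - 1) * derivative (ss p i) := by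
    linear_combination h3
  rw [h4, dvd_neg]
  refine Finset.dvd_sum fun i hi => Dvd.dvd.mul_right ?_ _
  have hi' : i < l := by simpa using hi
  refine (pow_dvd_pow X ?_).trans (pow_dvd_pow_of_dvd (ss_dvd p i) _)
  have : p ^ 1 ≤ p ^ (l - i) := Nat.pow_le_pow_right hpF.out.pos (by omega)
  simpa using Nat.sub_le_sub_right this 1

end wittpoly

section fil

set_option linter.unusedSectionVars false

open Classical in
theorem coeff_init' {p : ℕ} {A : Type*} [CommRing A] (B : WittVector p A) (n i : ℕ) :
    (WittVector.init n B).coeff i = if i < n then B.coeff i else 0 := by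
  simp only [WittVector.init, WittVector.select, WittVector.coeff_mk]
  split_ifs <;> rfl

open Classical in
theorem coeff_tail' {p : ℕ} {A : Type*} [CommRing A] (B : WittVector p A) (n i : ℕ) :
    (WittVector.tail n B).coeff i = if n ≤ i then B.coeff i else 0 := by
  simp only [WittVector.tail, WittVector.select, WittVector.coeff_mk]
  split_ifs <;> rfl

variable (p : ℕ) [hpF : Fact p.Prime] (m : ℕ)

/-- Witt vectors with integral components up to index `m`. -/
def IntW (A : WittVector p (LaurentSeries F)) : Prop := ∀ i ≤ m, ordGe (A.coeff i) 0

/-- The filtration on full Witt vectors, looking only at components up to index `m`. -/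
def FilW (N : ℤ) (A : WittVector p (LaurentSeries F)) : Prop :=
  ∀ i ≤ m, A.coeff i = 0 ∨ -N ≤ (p : ℤ) ^ (m - i) * (A.coeff i).order

/-- The ring of integral Laurent series. -/
def OO (F : Type*) [Field F] : Subring (LaurentSeries F) where
  carrier := {x | ordGe x 0}
  mul_mem' hx hy := by simpa using ordGe.mul hx hy
  one_mem' := ordGe_one
  add_mem' hx hy := ordGe.add hx hy
  zero_mem' := ordGe_zero 0
  neg_mem' hx := ordGe.neg hx

variable {p m}

theorem mem_OO {x : LaurentSeries F} : x ∈ OO F ↔ ordGe x 0 := Iff.rfl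

theorem exists_lift {A : WittVector p (LaurentSeries F)} (hA : IntW p m A) :
    ∃ B : WittVector p (OO F), WittVector.map (OO F).subtype B = WittVector.init (m + 1) A := by
  have h : ∀ i, (WittVector.init (m + 1) A).coeff i ∈ OO F := by
    intro i
    rw [coeff_init']
    split_ifs with h
    · exact hA i (by omega)
    · exact ordGe_zero 0
  refine ⟨WittVector.mk p fun i => ⟨_, h i⟩, ?_⟩
  ext i
  rw [WittVector.map_coeff]
  rfl

theorem coeff_init {A : WittVector p (LaurentSeries F)} {i : ℕ} (hi : i ≤ m) :
    (WittVector.init (m + 1) A).coeff i = A.coeff i := by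
  rw [coeff_init']
  rw [if_pos (by omega)]

theorem IntW.add {A B : WittVector p (LaurentSeries F)} (hA : IntW p m A) (hB : IntW p m B) :
    IntW p m (A + B) := by
  obtain ⟨A', hA'⟩ := exists_lift hA
  obtain ⟨B', hB'⟩ := exists_lift hB
  intro i hi
  rw [← coeff_init hi, WittVector.init_add, ← hA', ← hB', ← map_add, coeff_init hi,
    WittVector.map_coeff]
  exact ((A' + B').coeff i).2

theorem IntW.neg {A : WittVector p (LaurentSeries F)} (hA : IntW p m A) :
    IntW p m (-A) := by
  obtain ⟨A', hA'⟩ := exists_lift hA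
  intro i hi
  rw [← coeff_init hi, WittVector.init_neg, ← hA', ← map_neg, coeff_init hi,
    WittVector.map_coeff]
  exact ((-A').coeff i).2


/-- Scaling of a Witt vector. -/
def scaleW {A : Type*} [CommRing A] (z : A) (B : WittVector p A) : WittVector p A :=
  WittVector.mk p fun i => z ^ p ^ i * B.coeff i

theorem map_scaleW {A A' : Type*} [CommRing A] [CommRing A'] (f : A →+* A') (z : A)
    (B : WittVector p A) :
    WittVector.map f (scaleW z B) = scaleW (f z) (WittVector.map f B) := by
  ext i
  rw [WittVector.map_coeff]
  simp [scaleW, WittVector.map_coeff]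

theorem ghost_scaleW {A : Type*} [CommRing A] (z : A) (B : WittVector p A) (n : ℕ) :
    WittVector.ghostComponent n (scaleW z B) = z ^ p ^ n * WittVector.ghostComponent n B := by
  rw [WittVector.ghostComponent_apply, WittVector.ghostComponent_apply,
    wittPolynomial_eq_sum_C_mul_X_pow]
  simp only [map_sum, map_mul, map_pow, MvPolynomial.aeval_X, MvPolynomial.aeval_C, Finset.mul_sum]
  refine Finset.sum_congr rfl fun i hi => ?_
  have hi' : i ≤ n := by simp at hi; omega
  have : (scaleW z B).coeff i = z ^ p ^ i * B.coeff i := rfl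
  rw [this, mul_pow, ← pow_mul, ← pow_add, Nat.add_sub_cancel' hi']
  ring

theorem teich_mul_aux1 {σ : Type*} (z : MvPolynomial σ ℚ) (B : WittVector p (MvPolynomial σ ℚ)) :
    WittVector.teichmuller p z * B = scaleW z B := by
  apply (WittVector.ghostMap.bijective_of_invertible p (MvPolynomial σ ℚ)).1
  rw [map_mul]
  ext1 n
  simp only [Pi.mul_apply, WittVector.ghostMap_apply, ghost_scaleW,
    WittVector.ghostComponent_teichmuller]

theorem teich_mul_aux2 {σ : Type*} (z : MvPolynomial σ ℤ) (B : WittVector p (MvPolynomial σ ℤ)) :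
    WittVector.teichmuller p z * B = scaleW z B := by
  refine WittVector.map_injective (MvPolynomial.map (Int.castRingHom ℚ))
    (MvPolynomial.map_injective _ Int.cast_injective) ?_
  rw [map_mul, WittVector.map_teichmuller, map_scaleW, teich_mul_aux1]

theorem teich_mul {A : Type*} [CommRing A] (z : A) (B : WittVector p A) :
    WittVector.teichmuller p z * B = scaleW z B := by
  obtain ⟨z, rfl⟩ := MvPolynomial.counit_surjective A z
  obtain ⟨B, rfl⟩ := WittVector.map_surjective (MvPolynomial.counit A : _ →+* A)
    (MvPolynomial.counit_surjective A) B
  rw [← WittVector.map_teichmuller, ← map_mul, teich_mul_aux2, map_scaleW]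

theorem teich_mul_coeff {A : Type*} [CommRing A] (z : A) (B : WittVector p A) (i : ℕ) :
    (WittVector.teichmuller p z * B).coeff i = z ^ p ^ i * B.coeff i := by
  rw [teich_mul]; rfl

/-- Twist turning the filtration into integrality. -/
def twist (p : ℕ) [hpF : Fact p.Prime] (m : ℕ) [CharP (LaurentSeries F) p] (N : ℤ) :
    WittVector p (LaurentSeries F) →+ WittVector p (LaurentSeries F) :=
  (AddMonoidHom.mulLeft (WittVector.teichmuller p ((tt : LaurentSeries F) ^ N))).comp
    (WittVector.map (iterateFrobenius (LaurentSeries F) p m)).toAddMonoidHom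

variable [CharP (LaurentSeries F) p]

theorem coeff_twist (N : ℤ) (A : WittVector p (LaurentSeries F)) (i : ℕ) :
    (twist p m N A).coeff i = (tt ^ N) ^ p ^ i * (A.coeff i) ^ p ^ m := by
  change WittVector.coeff (WittVector.teichmuller p ((tt : LaurentSeries F) ^ N) *
    WittVector.map (iterateFrobenius (LaurentSeries F) p m) A) i = _
  rw [teich_mul_coeff, WittVector.map_coeff, iterateFrobenius_def]

theorem filW_iff (N : ℤ) (A : WittVector p (LaurentSeries F)) :
    FilW p m N A ↔ IntW p m (twist p m N A) := by
  unfold FilW IntW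
  refine forall₂_congr fun i hi => ?_
  rw [coeff_twist]
  have hz : ((tt : LaurentSeries F) ^ N) ^ p ^ i ≠ 0 := pow_ne_zero _ (zpow_ne_zero _ tt_ne)
  by_cases h : A.coeff i = 0
  · have hp := hpF.out.ne_zero
    simp [h, hp, ordGe_zero]
  · have h2 : (A.coeff i) ^ p ^ m ≠ 0 := pow_ne_zero _ h
    unfold ordGe
    rw [HahnSeries.order_mul hz h2, HahnSeries.order_pow, HahnSeries.order_pow, order_tt_zpow]
    simp only [h, false_or, mul_ne_zero hz h2, nsmul_eq_mul]
    have hm : p ^ m = p ^ i * p ^ (m - i) := by rw [← pow_add]; congr 1; omega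
    rw [hm]
    push_cast
    have hpos : (0 : ℤ) < (p : ℤ) ^ i := by have := hpF.out.pos; positivity
    have : (p : ℤ) ^ i * N + (p : ℤ) ^ i * (p : ℤ) ^ (m - i) * (A.coeff i).order =
      (p : ℤ) ^ i * (N + (p : ℤ) ^ (m - i) * (A.coeff i).order) := by ring
    rw [this, mul_nonneg_iff_of_pos_left hpos]
    constructor <;> intro h <;> linarith

theorem FilW.add {N : ℤ} {A B : WittVector p (LaurentSeries F)} (hA : FilW p m N A)
    (hB : FilW p m N B) : FilW p m N (A + B) := by
  rw [filW_iff] at *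
  rw [map_add]; exact hA.add hB

theorem FilW.neg {N : ℤ} {A : WittVector p (LaurentSeries F)} (hA : FilW p m N A) :
    FilW p m N (-A) := by
  rw [filW_iff] at *
  rw [map_neg]; exact hA.neg

theorem FilW_of_zero {N : ℤ} {A : WittVector p (LaurentSeries F)} (hA : ∀ i ≤ m, A.coeff i = 0) :
    FilW p m N A := fun i hi => Or.inl (hA i hi)

theorem FilW.sum {N : ℤ} {ι : Type*} {s : Finset ι} {A : ι → WittVector p (LaurentSeries F)}
    (hA : ∀ i ∈ s, FilW p m N (A i)) : FilW p m N (∑ i ∈ s, A i) := by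
  classical
  induction s using Finset.induction_on with
  | empty => exact FilW_of_zero fun i _ => by simp
  | insert a s ha ih =>
    rw [Finset.sum_insert ha]
    exact (hA a (by simp)).add (ih fun i hi => hA i (by simp [hi]))

theorem FilW.mono {N M : ℤ} {A : WittVector p (LaurentSeries F)} (hA : FilW p m N A)
    (h : N ≤ M) : FilW p m M A :=
  fun i hi => (hA i hi).imp id fun h' => by linarith

theorem filW_congr {N : ℤ} {A : WittVector p (LaurentSeries F)} :
    FilW p m N A ↔ ∀ i ≤ m, A.coeff i = 0 ∨ -N ≤ (p : ℤ) ^ (m - i) * (A.coeff i).order := Iff.rfl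

/-- `V^m B` only sees the constant coefficient. -/
theorem FilW_V {N : ℤ} {B : WittVector p (LaurentSeries F)} (h : ordGe (B.coeff 0) (-N)) :
    FilW p m N (WittVector.verschiebung^[m] B) := by
  intro i hi
  rcases hi.lt_or_eq with hi | rfl
  · left; exact WittVector.iterate_verschiebung_coeff_eq_zero _ hi
  · have := WittVector.iterate_verschiebung_coeff B i 0
    rw [zero_add] at this
    rw [this]
    simpa [ordGe] using h

/-- Splitting off the `m`-th component. -/
theorem FilW_split {N : ℤ} {B : WittVector p (LaurentSeries F)}
    (h : ∀ i < m, B.coeff i = 0 ∨ -N ≤ (p : ℤ) ^ (m - i) * (B.coeff i).order) :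
    FilW p m N (B - WittVector.verschiebung^[m] (WittVector.teichmuller p (B.coeff m))) := by
  have hB : B = WittVector.init m B + WittVector.tail m B := (WittVector.init_add_tail B m).symm
  have h1 : FilW p m N (WittVector.init m B) := by
    intro i hi
    rw [coeff_init']
    split_ifs with h'
    · exact h i h'
    · left; rfl
  have h2 : WittVector.tail m B = WittVector.verschiebung^[m] (WittVector.shift B m) := by
    ext1 i
    rw [coeff_tail']
    split_ifs with h'
    · obtain ⟨j, rfl⟩ := Nat.exists_eq_add_of_le' h'
      rw [WittVector.iterate_verschiebung_coeff, WittVector.shift_coeff, add_comm]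
    · rw [WittVector.iterate_verschiebung_coeff_eq_zero _ (by omega)]
  have h3 : B - WittVector.verschiebung^[m] (WittVector.teichmuller p (B.coeff m)) =
      WittVector.init m B + WittVector.verschiebung^[m]
        (WittVector.shift B m - WittVector.teichmuller p (B.coeff m)) := by
    conv_lhs => rw [hB]
    rw [h2, iterate_map_sub]
    have : (WittVector.init m B + WittVector.verschiebung^[m] (WittVector.shift B m)).coeff m =
        B.coeff m := by rw [← h2, ← hB]
    rw [this]; abel
  rw [h3]
  refine h1.add (FilW_V ?_)
  left
  have : (WittVector.constantCoeff : WittVector p (LaurentSeries F) →+* _)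
    (WittVector.shift B m - WittVector.teichmuller p (B.coeff m)) = 0 := by
    rw [map_sub, sub_eq_zero]
    simp [WittVector.constantCoeff, WittVector.shift_coeff]
  exact this

end fil

section key

set_option linter.unusedSectionVars false

open Polynomial

variable {K : Type*} [Field K] (D : Derivation ℤ K K)

/-- Coefficientwise derivation. -/
def Dp : Derivation ℤ K[X] K[X] :=
  letI : Differential K := ⟨D⟩
  Differential.mapCoeffs

theorem coeff_Dp (f : K[X]) (i : ℕ) : (Dp D f).coeff i = D (f.coeff i) := rfl

/-- The operator `d/dX - D`. -/
def Del (f : K[X]) : K[X] := derivative f - Dp D f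

theorem Del_mul (f g : K[X]) : Del D (f * g) = f * Del D g + g * Del D f := by
  unfold Del
  rw [derivative_mul, Derivation.leibniz, smul_eq_mul, smul_eq_mul]; ring

theorem Del_pow {q : K[X]} {f : K[X]} (h : q ∣ Del D f) (n : ℕ) : q ∣ Del D (f ^ n) := by
  induction n with
  | zero => simp [Del]
  | succ n ih =>
    rw [pow_succ, Del_mul]
    exact dvd_add (h.mul_left _) (ih.mul_left _)

theorem D_leib (x y : K) : D (x * y) = x * D y + y * D x := by
  rw [Derivation.leibniz, smul_eq_mul, smul_eq_mul]

theorem D_one : D 1 = 0 := Derivation.map_one_eq_zero D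

theorem D_pow_char (p : ℕ) [CharP K p] (x : K) : D (x ^ p) = 0 := by
  rw [Derivation.leibniz_pow]
  simp

theorem D_inv_natCast_mul (n : ℕ) (y : K) : D ((n : K)⁻¹ * y) = (n : K)⁻¹ * D y := by
  rw [Derivation.leibniz, Derivation.leibniz_inv]
  simp

theorem X_pow_dvd_Dp {n : ℕ} {f : K[X]} (h : X ^ n ∣ f) : X ^ n ∣ Dp D f := by
  rw [X_pow_dvd_iff] at *
  intro d hd
  rw [coeff_Dp, h d hd, map_zero]

variable (p : ℕ) [hpF : Fact p.Prime] [CharP K p]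


theorem natCast_ne {i : ℕ} (h0 : 0 < i) (hi : i < p) : (i : K) ≠ 0 := by
  intro h
  rw [CharP.cast_eq_zero_iff K p] at h
  exact absurd (Nat.le_of_dvd h0 h) (by omega)

theorem factorial_ne {i : ℕ} (hi : i < p) : (i.factorial : K) ≠ 0 := by
  intro h
  rw [CharP.cast_eq_zero_iff K p, hpF.out.dvd_factorial] at h
  omega

/-- The truncated Taylor expansion. -/
def PP (x : K) : K[X] := ∑ i ∈ Finset.range p, monomial i ((i.factorial : K)⁻¹ * D^[i] x)


theorem coeff_PP (x : K) (i : ℕ) :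
    (PP D p x).coeff i = if i < p then (i.factorial : K)⁻¹ * D^[i] x else 0 := by
  unfold PP
  simp [coeff_monomial]

theorem Del_PP (x : K) : X ^ (p - 1) ∣ Del D (PP D p x) := by
  rw [X_pow_dvd_iff]
  intro d hd
  unfold Del
  rw [coeff_sub, coeff_derivative, coeff_Dp, coeff_PP, coeff_PP, if_pos (by omega),
    if_pos (by omega), D_inv_natCast_mul, Function.iterate_succ_apply', Nat.factorial_succ]
  have h1 := factorial_ne (K := K) p (i := d) (by omega)
  have h2 := natCast_ne (K := K) p (i := d + 1) (by omega) (by omega)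
  push_cast at *
  field_simp
  simp

theorem coeff_of_Del {f : K[X]} (hf : X ^ (p - 1) ∣ Del D f) {i : ℕ} (hi : i < p) :
    f.coeff i = (i.factorial : K)⁻¹ * D^[i] (f.coeff 0) := by
  induction i with
  | zero => simp
  | succ i ih =>
    rw [X_pow_dvd_iff] at hf
    have h := hf i (by omega)
    unfold Del at h
    rw [coeff_sub, coeff_derivative, coeff_Dp, ih (by omega), D_inv_natCast_mul, sub_eq_zero] at h
    rw [Function.iterate_succ_apply', Nat.factorial_succ]
    have h1 := factorial_ne (K := K) p (i := i) (by omega)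
    have h2 := natCast_ne (K := K) p (i := i + 1) (by omega) (by omega)
    push_cast at *
    field_simp at *
    exact h

theorem derivative_eval₂_int (f : ℤ[X]) (Z : K[X]) :
    derivative (eval₂ (Int.castRingHom K[X]) Z f) =
      eval₂ (Int.castRingHom K[X]) Z (derivative f) * derivative Z := by
  have h (g : ℤ[X]) : eval₂ (Int.castRingHom K[X]) Z g = (g.map (Int.castRingHom K)).comp Z := by
    rw [comp, eval₂_map]
    congr 1
  rw [h, h, derivative_comp, derivative_map, mul_comm]

/-- `P/x - 1`. -/
def ZZ (x : K) : K[X] := PP D p x * C x⁻¹ - 1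

/-- `x^{p^l} s_l(P/x - 1)`. -/
def QQ (l : ℕ) (x : K) : K[X] :=
  C (x ^ p ^ l) * eval₂ (Int.castRingHom K[X]) (ZZ D p x) (ss p l)


theorem X_dvd_ZZ {x : K} (hx : x ≠ 0) : X ∣ ZZ D p x := by
  rw [X_dvd_iff]
  unfold ZZ
  rw [coeff_sub, coeff_mul_C, coeff_PP, if_pos hpF.out.pos]
  simp [hx]


theorem coeff_QQ_zero (l : ℕ) {x : K} (hx : x ≠ 0) : (QQ D p l x).coeff 0 = 0 := by
  rw [← X_dvd_iff]
  refine Dvd.dvd.mul_left ?_ _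
  obtain ⟨h, hh⟩ := ss_dvd p l
  rw [hh, eval₂_mul, eval₂_X]
  exact (X_dvd_ZZ D p hx).mul_right _

theorem derivative_QQ (l : ℕ) {x : K} (hx : x ≠ 0) :
    X ^ (p - 1) ∣ derivative (QQ D p l x) - PP D p x ^ (p ^ l - 1) * Dp D (PP D p x) := by
  obtain ⟨h, hh⟩ := ss_deriv p l
  have h1 : derivative (ss p l) = (1 + X) ^ (p ^ l - 1) + X ^ (p - 1) * h := by
    linear_combination hh
  have hC : (C x * C x⁻¹ : K[X]) = 1 := by rw [← C_mul, mul_inv_cancel₀ hx, C_1]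
  have hZ : derivative (ZZ D p x) = derivative (PP D p x) * C x⁻¹ := by
    unfold ZZ; simp
  have hpl : p ^ l = p ^ l - 1 + 1 := by
    have := Nat.pos_of_ne_zero (pow_ne_zero l hpF.out.ne_zero); omega
  have h2 : C (x ^ p ^ l) * ((1 + ZZ D p x) ^ (p ^ l - 1) * (derivative (PP D p x) * C x⁻¹)) =
      PP D p x ^ (p ^ l - 1) * derivative (PP D p x) := by
    have : 1 + ZZ D p x = PP D p x * C x⁻¹ := by unfold ZZ; ring
    rw [this, mul_pow]
    have h3 : (C (x ^ p ^ l) : K[X]) * C x⁻¹ ^ (p ^ l - 1) * C x⁻¹ = 1 := by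
      rw [mul_assoc, ← pow_succ, ← hpl, C_pow, ← mul_pow, hC, one_pow]
    linear_combination (PP D p x ^ (p ^ l - 1) * derivative (PP D p x)) * h3
  have h4 : derivative (QQ D p l x) - PP D p x ^ (p ^ l - 1) * Dp D (PP D p x) =
      PP D p x ^ (p ^ l - 1) * Del D (PP D p x) +
      (ZZ D p x) ^ (p - 1) * (C (x ^ p ^ l) * eval₂ (Int.castRingHom K[X]) (ZZ D p x) h *
        derivative (ZZ D p x)) := by
    unfold QQ
    rw [derivative_C_mul, derivative_eval₂_int, h1]
    simp only [eval₂_add, eval₂_mul, eval₂_pow, eval₂_one, eval₂_X]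
    rw [hZ]
    unfold Del
    linear_combination h2
  rw [h4]
  exact dvd_add ((Del_PP D p x).mul_left _)
    ((pow_dvd_pow_of_dvd (X_dvd_ZZ D p hx) _).mul_right _)

theorem coeff_QQ_succ (l : ℕ) {x : K} (hx : x ≠ 0) {i : ℕ} (hi : i + 1 < p) :
    (QQ D p l x).coeff (i + 1) =
      ((i + 1).factorial : K)⁻¹ * D^[i] (x ^ (p ^ l - 1) * D x) := by
  set R := PP D p x ^ (p ^ l - 1) * Dp D (PP D p x) with hR
  have hDel : X ^ (p - 1) ∣ Del D R := by
    rw [hR, Del_mul]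
    refine dvd_add (Dvd.dvd.mul_left ?_ _) ((Del_pow D (Del_PP D p x) _).mul_left _)
    have h := X_pow_dvd_Dp D (Del_PP D p x)
    have h2 : Del D (Dp D (PP D p x)) = Dp D (Del D (PP D p x)) := by
      ext j
      unfold Del
      simp only [map_sub, coeff_sub, coeff_derivative, coeff_Dp, Derivation.leibniz]
      simp [mul_comm]
    rw [h2]; exact h
  have hR0 : R.coeff 0 = x ^ (p ^ l - 1) * D x := by
    rw [hR, mul_coeff_zero, coeff_Dp, coeff_zero_eq_eval_zero, eval_pow, ← coeff_zero_eq_eval_zero,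
      coeff_PP, if_pos hpF.out.pos]
    simp
  have h1 := coeff_of_Del D p hDel (i := i) (by omega)
  have h2 := X_pow_dvd_iff.1 (derivative_QQ D p l hx) i (by omega)
  rw [coeff_sub, coeff_derivative, ← hR, h1, hR0, sub_eq_zero] at h2
  rw [Nat.factorial_succ]
  have h3 := factorial_ne (K := K) p (i := i) (by omega)
  have h4 := natCast_ne (K := K) p (i := i + 1) (by omega) (by omega)
  push_cast at *
  field_simp at *
  linear_combination h2

end key

section taylor

open Polynomial

/-- The standing hypotheses on `u` and `v`. -/
structure Setup (k : Type*) [Field k] (r : ℕ)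
    (u v : LaurentSeries k →+* LaurentSeries (RatFunc k)) : Prop where
  hr : 1 ≤ r
  hv : ∀ (x : LaurentSeries k) (j : ℤ),
      (v x).coeff j = algebraMap k (RatFunc k) (x.coeff j)
  hu_alg : ∀ c : k,
      u (HahnSeries.single 0 c) = HahnSeries.single 0 (algebraMap k (RatFunc k) c)
  hu_t : u tt = tt * (1 + tt ^ r * θθ k)
  hu_cont : ∀ N : ℤ, ∃ M : ℤ, ∀ x : LaurentSeries k, ordGe x M → ordGe (u x) N

/-- `δ = t^{r+1} θ`. -/
def dd (k : Type*) [Field k] (r : ℕ) : LaurentSeries (RatFunc k) := tt ^ (r + 1) * θθ k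

theorem ordGe_dd (k : Type*) [Field k] (r : ℕ) : ordGe (dd k r) (r + 1) := by
  refine (ordGe_tt.pow (r + 1)).mul' (ordGe_single 0 _) (by push_cast; omega)

instance charP_laurent (F : Type*) [Field F] (p : ℕ) [CharP F p] : CharP (LaurentSeries F) p :=
  charP_of_injective_ringHom (f := (HahnSeries.C : F →+* HahnSeries ℤ F))
    HahnSeries.C_injective p

variable {k : Type*} [Field k] {r : ℕ} {u v : LaurentSeries k →+* LaurentSeries (RatFunc k)}

theorem Setup.ordGe_v (S : Setup k r u v) {x : LaurentSeries k} {N : ℤ} (h : ordGe x N) :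
    ordGe (v x) N := by
  rw [ordGe_iff] at *
  intro j hj
  rw [S.hv, h j hj, map_zero]

theorem Setup.v_tt (S : Setup k r u v) : v tt = tt := by
  ext j
  rw [S.hv]
  unfold tt
  rw [HahnSeries.coeff_single, HahnSeries.coeff_single]
  split_ifs <;> simp

theorem Setup.v_single (S : Setup k r u v) (c : k) :
    v (HahnSeries.single 0 c) = HahnSeries.single 0 (algebraMap k (RatFunc k) c) := by
  ext j
  rw [S.hv]
  rw [HahnSeries.coeff_single, HahnSeries.coeff_single]
  split_ifs <;> simp

theorem Setup.u_tt (S : Setup k r u v) : u tt = tt + dd k r := by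
  rw [S.hu_t]; unfold dd; ring

theorem Setup.ordGe_term (S : Setup k r u v) {x : LaurentSeries k} {N : ℤ} {i : ℕ}
    (h : ordGe x (N - i)) : ordGe (v x * dd k r ^ i) (N + i * r) :=
  (S.ordGe_v h).mul' ((ordGe_dd k r).pow i) (by linarith)

theorem Setup.eval_bound (S : Setup k r u v) {f : (LaurentSeries k)[X]} {N : ℤ}
    (h : ∀ i, ordGe (f.coeff i) (N - i)) (q : ℕ) :
    ordGe (eval₂ v (dd k r) f - ∑ i ∈ Finset.range q, v (f.coeff i) * dd k r ^ i)
      (N + q * r) := by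
  rw [eval₂_eq_sum_range' v (n := q + (f.natDegree + 1)) (by omega), Finset.sum_range_add,
    add_sub_cancel_left]
  refine ordGe.sum fun i _ => (S.ordGe_term (h (q + i))).mono ?_
  push_cast
  have : (0 : ℤ) ≤ (i : ℤ) * r := by positivity
  linarith

theorem Setup.eval_bound0 (S : Setup k r u v) {f : (LaurentSeries k)[X]} {N : ℤ}
    (h : ∀ i, ordGe (f.coeff i) (N - i)) : ordGe (eval₂ v (dd k r) f) N := by
  simpa using S.eval_bound h 0

variable (p : ℕ) [hpF : Fact p.Prime] [CharP k p]

theorem coeff_PP_bound {x : LaurentSeries k} {N : ℤ} (h : ordGe x N) (i : ℕ) :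
    ordGe ((PP DD p x).coeff i) (N - i) := by
  rw [coeff_PP]
  split_ifs
  · exact (ordGe.inv_natCast _).mul' (ordGe_DD_iter h i) (by omega)
  · exact ordGe_zero _

theorem PP_add (x y : LaurentSeries k) : PP DD p (x + y) = PP DD p x + PP DD p y := by
  ext1 i
  rw [coeff_add, coeff_PP, coeff_PP, coeff_PP, iterate_map_add]
  split_ifs
  · rw [mul_add]
  · simp

theorem PP_const_mul {a : LaurentSeries k} (ha : DD a = 0) (x : LaurentSeries k) :
    PP DD p (a * x) = C a * PP DD p x := by
  have h : ∀ i, DD^[i] (a * x) = a * DD^[i] x := by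
    intro i
    induction i with
    | zero => rfl
    | succ i ih =>
      rw [Function.iterate_succ_apply', Function.iterate_succ_apply', ih, D_leib, ha]
      simp
  ext1 i
  rw [coeff_C_mul, coeff_PP, coeff_PP, h]
  split_ifs
  · ring
  · simp

variable (r v) in
/-- Truncated Taylor expansion, as an additive map to `L`. -/
def TT : LaurentSeries k →+ LaurentSeries (RatFunc k) :=
  AddMonoidHom.mk' (fun x => eval₂ v (dd k r) (PP DD p x)) fun x y => by
    rw [PP_add, eval₂_add]

theorem TT_apply (x : LaurentSeries k) : TT r v p x = eval₂ v (dd k r) (PP DD p x) := rfl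

theorem Setup.ordGe_TT (S : Setup k r u v) {x : LaurentSeries k} {N : ℤ} (h : ordGe x N) :
    ordGe (TT r v p x) N :=
  S.eval_bound0 (coeff_PP_bound p h)

theorem Setup.ordGe_TT_sub (S : Setup k r u v) {x : LaurentSeries k} {N : ℤ} (h : ordGe x N) :
    ordGe (TT r v p x - v x) (N + r) := by
  have := S.eval_bound (coeff_PP_bound p h) 1
  simpa [TT_apply, coeff_PP, hpF.out.pos] using this

theorem TT_const_mul {a : LaurentSeries k} (ha : DD a = 0) (x : LaurentSeries k) :
    TT r v p (a * x) = v a * TT r v p x := by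
  rw [TT_apply, PP_const_mul p ha, eval₂_mul, eval₂_C, TT_apply]

theorem PP_tt_pow {j : ℕ} (hj : j < p) :
    PP DD p ((tt : LaurentSeries k) ^ j) = (C tt + X) ^ j := by
  have := charP_laurent k p
  have h0 : Del DD (C (tt : LaurentSeries k) + X) = 0 := by
    ext1 i
    unfold Del
    rw [coeff_sub, coeff_Dp, derivative_add, derivative_C, derivative_X, zero_add, coeff_add]
    rcases i with _ | i
    · simp [DD_tt]
    · rw [coeff_C_succ, zero_add, coeff_one, coeff_X]
      rw [if_neg (by omega), zero_sub, coeff_zero, neg_eq_zero]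
      split_ifs
      · exact D_one _
      · exact map_zero _
  have h1 : X ^ (p - 1) ∣ Del DD ((C (tt : LaurentSeries k) + X) ^ j) :=
    Del_pow DD (by rw [h0]; exact dvd_zero _) j
  ext1 i
  rw [coeff_PP]
  split_ifs with hi
  · rw [coeff_of_Del DD p h1 hi, coeff_zero_eq_eval_zero]
    simp
  · symm
    apply coeff_eq_zero_of_natDegree_lt
    have h2 : ((C (tt : LaurentSeries k) + X) ^ j).natDegree ≤ j * 1 :=
      natDegree_pow_le_of_le j (natDegree_add_le_of_degree_le (by simp) (by simp))
    omega

theorem Setup.TT_tt_pow (S : Setup k r u v) {j : ℕ} (hj : j < p) :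
    TT r v p (tt ^ j) = (u tt) ^ j := by
  rw [TT_apply, PP_tt_pow p hj, eval₂_pow, eval₂_add, eval₂_C, eval₂_X, S.v_tt, S.u_tt]

theorem one_unit_mul {L : Type*} [Field L] {e f : LaurentSeries L} {r : ℕ}
    (he : ordGe (e - 1) r) (hf : ordGe (f - 1) r) : ordGe (e * f - 1) r := by
  have hf0 : ordGe f 0 := by
    have : f = (f - 1) + 1 := by ring
    rw [this]
    exact (hf.mono (by omega)).add ordGe_one
  have : e * f - 1 = (e - 1) * f + (f - 1) := by ring
  rw [this]
  exact (he.mul' hf0 (by omega)).add hf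

theorem one_unit_inv {L : Type*} [Field L] {e : LaurentSeries L} {r : ℕ} (hr : 1 ≤ r)
    (he : ordGe (e - 1) r) : ordGe (e⁻¹ - 1) r := by
  have h0 : e.coeff 0 = 1 := by
    have := ordGe_iff.1 he 0 (by omega)
    simpa [sub_eq_zero] using this
  have hne : e ≠ 0 := by rintro rfl; simp at h0
  have hle : e.order ≤ 0 := HahnSeries.order_le_of_coeff_ne_zero (by rw [h0]; exact one_ne_zero)
  have hi : ordGe e⁻¹ 0 := Or.inr (by rw [order_inv' hne]; omega)
  have : e⁻¹ - 1 = -((e - 1) * e⁻¹) := by field_simp; ring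
  rw [this]
  exact (he.mul' hi (by omega)).neg

theorem one_unit_pow {L : Type*} [Field L] {e : LaurentSeries L} {r : ℕ}
    (he : ordGe (e - 1) r) (n : ℕ) : ordGe (e ^ n - 1) r := by
  induction n with
  | zero => simpa using ordGe_zero _
  | succ n ih => rw [pow_succ]; exact one_unit_mul ih he

theorem one_unit_zpow {L : Type*} [Field L] {e : LaurentSeries L} {r : ℕ} (hr : 1 ≤ r)
    (he : ordGe (e - 1) r) (n : ℤ) : ordGe (e ^ n - 1) r := by
  rcases n with n | n
  · simpa using one_unit_pow he n
  · rw [zpow_negSucc]; exact one_unit_inv hr (one_unit_pow he _)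

theorem single_eq (j : ℤ) (c : F) :
    (HahnSeries.single j c : LaurentSeries F) = HahnSeries.single 0 c * tt ^ j := by
  have h : (tt : LaurentSeries F) ^ j = HahnSeries.single j 1 := by
    unfold tt
    exact (RatFunc.single_zpow j).symm
  rw [h, HahnSeries.single_mul_single]
  simp

theorem Setup.taylor_single (S : Setup k r u v) (j : ℤ) (c : k) :
    ordGe (u (HahnSeries.single j c) - TT r v p (HahnSeries.single j c)) (j + p * r) := by
  have := charP_laurent k p
  have : CharP (RatFunc k) p := charP_of_injective_algebraMap (algebraMap k (RatFunc k)).injective p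
  have := charP_laurent (RatFunc k) p
  have hp0 : (p : ℤ) ≠ 0 := by exact_mod_cast hpF.out.ne_zero
  have hpp : (0 : ℤ) < p := by exact_mod_cast hpF.out.pos
  obtain ⟨j0, hj0⟩ : ∃ j0 : ℕ, (j0 : ℤ) = j % p :=
    ⟨(j % p).toNat, Int.toNat_of_nonneg (Int.emod_nonneg _ hp0)⟩
  have hj0p : j0 < p := by have := Int.emod_lt_of_pos j hpp; omega
  set q := j / p with hq
  have hj : j = q * p + j0 := by
    have := Int.emod_add_mul_ediv j p
    rw [hj0, hq]; linarith
  have hx : (HahnSeries.single j c : LaurentSeries k) =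
      (HahnSeries.single 0 c * (tt ^ q) ^ p) * tt ^ j0 := by
    rw [single_eq, hj, zpow_add₀ tt_ne, zpow_mul, zpow_natCast, zpow_natCast, mul_assoc]
  have hD : DD (HahnSeries.single 0 c * ((tt : LaurentSeries k) ^ q) ^ p) = 0 := by
    rw [D_leib, DD_single_zero, D_pow_char]
    simp
  rw [hx, TT_const_mul p hD, S.TT_tt_pow p hj0p]
  simp only [map_mul, map_pow, map_zpow₀, S.hu_alg, S.v_single, S.v_tt]
  have hfac : ∀ A B C D : LaurentSeries (RatFunc k), A * B ^ p * C - A * D ^ p * C =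
      A * (B - D) ^ p * C := by
    intro A B C D; rw [sub_pow_char]; ring
  rw [hfac]
  have h1 : ordGe (u tt ^ q - tt ^ q) (q + r) := by
    rw [S.hu_t, mul_zpow]
    have : (tt : LaurentSeries (RatFunc k)) ^ q * (1 + tt ^ r * θθ k) ^ q - tt ^ q =
        tt ^ q * ((1 + tt ^ r * θθ k) ^ q - 1) := by ring
    rw [this]
    refine (ordGe_tt_zpow q).mul (one_unit_zpow S.hr ?_ q)
    rw [add_sub_cancel_left]
    exact (ordGe_tt.pow r).mul' (ordGe_single 0 _) (by omega)
  have h2 : ordGe (u tt) 1 := by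
    rw [S.u_tt]
    exact ordGe_tt.add ((ordGe_dd k r).mono (by omega))
  refine (((ordGe_single 0 _).mul (h1.pow p)).mul (h2.pow j0)).mono ?_
  rw [hj]; linarith

theorem Setup.taylor (S : Setup k r u v) {x : LaurentSeries k} {N : ℤ} (h : ordGe x N) :
    ordGe (u x - TT r v p x) (N + p * r) := by
  obtain ⟨M0, hM0⟩ := S.hu_cont (N + p * r)
  set M := max M0 (N + p * r) with hM
  set s : LaurentSeries k := ∑ j ∈ Finset.Ico N M, HahnSeries.single j (x.coeff j) with hs
  have hx : x = s + (x - s) := by ring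
  have ht : ordGe (x - s) M := by
    rw [ordGe_iff] at *
    intro j hj
    rw [HahnSeries.coeff_sub, hs, HahnSeries.coeff_sum]
    by_cases hj2 : N ≤ j
    · rw [Finset.sum_eq_single j]
      · simp
      · intro i _ hi
        exact HahnSeries.coeff_single_of_ne hi.symm
      · intro h'; simp at h'; omega
    · rw [h j (by omega), Finset.sum_eq_zero, sub_zero]
      intro i hi
      refine HahnSeries.coeff_single_of_ne ?_
      simp at hi; omega
  rw [hx, map_add, map_add, add_sub_add_comm]
  refine ordGe.add ?_ ((hM0 _ (ht.mono (le_max_left _ _))).sub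
    ((S.ordGe_TT p ht).mono (le_max_right _ _)))
  rw [hs, map_sum, map_sum, ← Finset.sum_sub_distrib]
  refine ordGe.sum fun j hj => (S.taylor_single p j _).mono ?_
  simp at hj; omega

end taylor

section key5

open Polynomial

/-- Polynomials whose `i`-th coefficient has order at least `-i`. -/
def MM (F : Type*) [Field F] : Subring (LaurentSeries F)[X] where
  carrier := {f | ∀ i : ℕ, ordGe (f.coeff i) (-i)}
  mul_mem' {f g} hf hg i := by
    rw [coeff_mul]
    refine ordGe.sum fun ij hij => (hf ij.1).mul' (hg ij.2) ?_
    have : ij.1 + ij.2 = i := by simpa using hij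
    omega
  one_mem' i := by
    rw [coeff_one]
    split_ifs with h
    · subst h; exact ordGe_one
    · exact ordGe_zero _
  add_mem' {f g} hf hg i := by
    rw [coeff_add]; exact (hf i).add (hg i)
  zero_mem' i := by
    rw [coeff_zero]; exact ordGe_zero _
  neg_mem' {f} hf i := by
    rw [coeff_neg]; exact (hf i).neg

theorem eval₂_int_mem {A : Type*} [CommRing A] (M : Subring A) {z : A} (hz : z ∈ M) (f : ℤ[X]) :
    eval₂ (Int.castRingHom A) z f ∈ M := by
  rw [eval₂_eq_sum_range]
  refine Subring.sum_mem _ fun i _ => Subring.mul_mem _ ?_ (Subring.pow_mem _ hz i)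
  simp

theorem ordGe_eval_sub {z w : LaurentSeries F} (hz : ordGe z 0) (hw : ordGe w 0) {N : ℤ}
    (h : ordGe (z - w) N) (f : ℤ[X]) :
    ordGe (eval₂ (Int.castRingHom _) z f - eval₂ (Int.castRingHom _) w f) N := by
  rw [eval₂_eq_sum_range, eval₂_eq_sum_range, ← Finset.sum_sub_distrib]
  have h1 : ∀ i : ℕ, ordGe (z ^ i - w ^ i) N := by
    intro i
    induction i with
    | zero => simpa using ordGe_zero N
    | succ i ih =>
      have : z ^ (i + 1) - w ^ (i + 1) = (z ^ i - w ^ i) * z + w ^ i * (z - w) := by ring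
      rw [this]
      exact (ih.mul' hz (by omega)).add ((hw.pow i).mul' h (by simp))
  refine ordGe.sum fun i _ => ?_
  rw [← mul_sub]
  have h2 : ordGe (Int.castRingHom (LaurentSeries F) (f.coeff i)) 0 :=
    mem_OO.1 (by simp)
  exact h2.mul' (h1 i) (by omega)

variable {k : Type*} [Field k] {r : ℕ} {u v : LaurentSeries k →+* LaurentSeries (RatFunc k)}
variable (p : ℕ) [hpF : Fact p.Prime] [CharP k p]

theorem ZZ_mem {x : LaurentSeries k} (hx : x ≠ 0) : ZZ DD p x ∈ MM k := by
  refine Subring.sub_mem _ ?_ (Subring.one_mem _)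
  intro i
  rw [coeff_mul_C]
  refine (coeff_PP_bound p (ordGe_self x) i).mul' (ordGe_self _) ?_
  rw [order_inv' hx]; omega

theorem Setup.order_v (S : Setup k r u v) (x : LaurentSeries k) : (v x).order = x.order := by
  by_cases hx : x = 0
  · simp [hx]
  have hvx : v x ≠ 0 := (map_ne_zero v).2 hx
  have h1 : ordGe (v x) x.order := S.ordGe_v (ordGe_self x)
  refine le_antisymm ?_ (h1.resolve_left hvx)
  refine HahnSeries.order_le_of_coeff_ne_zero ?_
  rw [S.hv]
  simpa using HahnSeries.coeff_order_eq_zero.not.2 hx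

theorem Setup.z_sub (S : Setup k r u v) {x : LaurentSeries k} (hx : x ≠ 0) :
    ordGe ((u x / v x - 1) - eval₂ v (dd k r) (ZZ DD p x)) (p * r) := by
  have h1 := S.taylor p (ordGe_self x)
  have h2 : eval₂ v (dd k r) (ZZ DD p x) = TT r v p x / v x - 1 := by
    unfold ZZ
    rw [eval₂_sub, eval₂_mul, eval₂_C, eval₂_one, TT_apply, map_inv₀, div_eq_mul_inv]
  rw [h2]
  have h3 : (u x / v x - 1) - (TT r v p x / v x - 1) = (u x - TT r v p x) * (v x)⁻¹ := by ring
  rw [h3]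
  refine h1.mul' (ordGe_self _) ?_
  rw [order_inv' ((map_ne_zero v).2 hx), S.order_v]; linarith

theorem Setup.z_bound (p : ℕ) [hpF : Fact p.Prime] [CharP k p] (S : Setup k r u v) {x : LaurentSeries k} (hx : x ≠ 0) :
    ordGe (u x / v x - 1) r := by
  have h1 := S.taylor p (ordGe_self x)
  have h2 := S.ordGe_TT_sub p (ordGe_self x)
  have hvx : v x ≠ 0 := (map_ne_zero v).2 hx
  have h3 : (u x / v x - 1) = ((u x - TT r v p x) + (TT r v p x - v x)) * (v x)⁻¹ := by
    field_simp; ring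
  rw [h3]
  have h4 : (r : ℤ) ≤ p * r := by
    have : (1 : ℤ) ≤ p := by exact_mod_cast hpF.out.one_lt.le
    nlinarith [Int.natCast_nonneg r]
  refine ((h1.mono (by omega)).add h2).mul' (ordGe_self _) ?_
  rw [order_inv' hvx, S.order_v]; omega

theorem Setup.key5 (S : Setup k r u v) {x : LaurentSeries k} (hx : x ≠ 0) (l : ℕ) :
    ordGe (v x ^ p ^ l * eval₂ (Int.castRingHom _) (u x / v x - 1) (ss p l) -
      ∑ i ∈ Finset.range (p - 1),
        v (((i + 1).factorial : LaurentSeries k)⁻¹ * DD^[i] (x ^ (p ^ l - 1) * lsDeriv x)) *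
          dd k r ^ (i + 1)) (p ^ l * x.order + p * r) := by
  set z' := eval₂ v (dd k r) (ZZ DD p x) with hz'
  have hM := ZZ_mem p hx
  have hz'0 : ordGe z' 0 := S.eval_bound0 (fun i => by simpa using hM i)
  have hz0 : ordGe (u x / v x - 1) 0 := (Setup.z_bound p S hx).mono (by omega)
  have h1 := ordGe_eval_sub hz0 hz'0 (S.z_sub p hx) (ss p l)
  have hvo : ordGe (v x ^ p ^ l) (p ^ l * x.order) := by
    have := (S.ordGe_v (ordGe_self x)).pow (p ^ l)
    push_cast at this; exact this
  have hQ : eval₂ v (dd k r) (QQ DD p l x) = v x ^ p ^ l * eval₂ (Int.castRingHom _) z' (ss p l) := by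
    unfold QQ
    rw [eval₂_mul, eval₂_C, map_pow]
    congr 1
    have := hom_eval₂ (ss p l) (Int.castRingHom (LaurentSeries k)[X]) (eval₂RingHom v (dd k r))
      (ZZ DD p x)
    simp only [coe_eval₂RingHom] at this
    rw [this, hz']
    congr 1
    exact Subsingleton.elim _ _
  have hQb : ∀ i, ordGe ((QQ DD p l x).coeff i) (p ^ l * x.order - i) := by
    intro i
    unfold QQ
    rw [coeff_C_mul]
    have h := (ordGe_self x).pow (p ^ l)
    refine h.mul' (eval₂_int_mem (MM k) hM (ss p l) i) ?_
    push_cast; omega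
  have h2 := S.eval_bound hQb p
  have hp1 : p = (p - 1) + 1 := by have := hpF.out.pos; omega
  have hsum : ∑ i ∈ Finset.range p, v ((QQ DD p l x).coeff i) * dd k r ^ i =
      ∑ i ∈ Finset.range (p - 1),
        v (((i + 1).factorial : LaurentSeries k)⁻¹ * DD^[i] (x ^ (p ^ l - 1) * lsDeriv x)) *
          dd k r ^ (i + 1) := by
    have hrg : Finset.range p = Finset.range (p - 1 + 1) := congrArg _ hp1
    rw [hrg, Finset.sum_range_succ', coeff_QQ_zero DD p l hx, map_zero, zero_mul, add_zero]
    refine Finset.sum_congr rfl fun i hi => ?_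
    have hi' : i < p - 1 := by simpa using hi
    rw [coeff_QQ_succ DD p l hx (by omega)]
    rfl
  rw [hsum, hQ] at h2
  have h3 := (hvo.mul h1).add h2
  convert h3 using 1
  ring

end key5

section assembly

set_option linter.unusedSectionVars false

open Polynomial

variable {k : Type*} [Field k] {r : ℕ} {u v : LaurentSeries k →+* LaurentSeries (RatFunc k)}
variable (p : ℕ)

variable (r v) in
/-- The truncated series `Σ_{1 ≤ i < p} v(D^{i-1} w) δ^i / i!`. -/
def SS : LaurentSeries k →+ LaurentSeries (RatFunc k) :=
  AddMonoidHom.mk' (fun w => ∑ i ∈ Finset.range (p - 1),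
    v (((i + 1).factorial : LaurentSeries k)⁻¹ * DD^[i] w) * dd k r ^ (i + 1)) fun x y => by
    rw [← Finset.sum_add_distrib]
    refine Finset.sum_congr rfl fun i _ => ?_
    rw [iterate_map_add, mul_add, map_add, add_mul]

theorem SS_apply (w : LaurentSeries k) : SS r v p w = ∑ i ∈ Finset.range (p - 1),
    v (((i + 1).factorial : LaurentSeries k)⁻¹ * DD^[i] w) * dd k r ^ (i + 1) := rfl

variable (u v) in
/-- The `l`-th component of `[u x] - [v x]`. -/
def GG [hpF : Fact p.Prime] (l : ℕ) (x : LaurentSeries k) : LaurentSeries (RatFunc k) :=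
  v x ^ p ^ l * eval₂ (Int.castRingHom _) (u x / v x - 1) (ss p l)

variable [hpF : Fact p.Prime]

theorem GG_zero (l : ℕ) : GG u v p l 0 = 0 := by
  unfold GG
  rw [map_zero, zero_pow (pow_ne_zero _ hpF.out.ne_zero), zero_mul]

variable [CharP k p]

theorem Setup.stepA (S : Setup k r u v) {ι : Type*} (s : Finset ι) (x : ι → LaurentSeries k)
    (l : ι → ℕ) {n : ℤ} (h : ∀ i ∈ s, x i = 0 ∨ -n ≤ (p : ℤ) ^ (l i) * (x i).order) :
    ordGe (∑ i ∈ s, GG u v p (l i) (x i) -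
      SS r v p (∑ i ∈ s, x i ^ (p ^ (l i) - 1) * lsDeriv (x i))) (-n + p * r) := by
  rw [map_sum, ← Finset.sum_sub_distrib]
  refine ordGe.sum fun i hi => ?_
  by_cases hx : x i = 0
  · have h0 : lsDeriv (0 : LaurentSeries k) = 0 := map_zero (DD (F := k))
    rw [hx, GG_zero, h0, mul_zero, map_zero, sub_zero]
    exact ordGe_zero _
  · have := (h i hi).resolve_left hx
    exact (S.key5 p hx (l i)).mono (by omega)

theorem Setup.stepB (S : Setup k r u v) (b : LaurentSeries k) :
    ordGe (u b - v b - SS r v p (lsDeriv b)) (b.order + p * r) := by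
  have h1 := S.taylor p (ordGe_self b)
  have h2 := S.eval_bound (coeff_PP_bound p (ordGe_self b)) p
  have hp1 : p = (p - 1) + 1 := by have := hpF.out.pos; omega
  have hrg : Finset.range p = Finset.range (p - 1 + 1) := congrArg _ hp1
  rw [← TT_apply, hrg, Finset.sum_range_succ'] at h2
  have h3 : ∑ i ∈ Finset.range (p - 1), v ((PP DD p b).coeff (i + 1)) * dd k r ^ (i + 1) =
      SS r v p (lsDeriv b) := by
    rw [SS_apply]
    refine Finset.sum_congr rfl fun i hi => ?_
    have hi' : i < p - 1 := by simpa using hi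
    rw [coeff_PP, if_pos (by omega), Function.iterate_succ_apply]
    rfl
  have h4 : v ((PP DD p b).coeff 0) * dd k r ^ 0 = v b := by
    rw [coeff_PP, if_pos hpF.out.pos]
    simp
  rw [h3, h4] at h2
  have := h1.add h2
  convert this using 1
  ring

/-- The commutator `D^j (c f) - c D^j f`. -/
theorem ordGe_comm {c f : LaurentSeries k} {A B : ℤ} (hc : ordGe (lsDeriv c) A) (hf : ordGe f B)
    (j : ℕ) : ordGe (DD^[j] (c * f) - c * DD^[j] f) (A + B - (j - 1)) := by
  induction j with
  | zero => simpa using ordGe_zero _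
  | succ j ih =>
    have h1 : DD^[j + 1] (c * f) - c * DD^[j + 1] f =
        DD (DD^[j] (c * f) - c * DD^[j] f) + lsDeriv c * DD^[j] f := by
      rw [Function.iterate_succ_apply', Function.iterate_succ_apply', map_sub, D_leib, ← DD_apply]
      ring
    rw [h1]
    refine ((ordGe_lsDeriv ih).mono ?_).add (hc.mul' (ordGe_DD_iter hf j) ?_)
    · push_cast; omega
    · push_cast; omega

theorem Setup.stepC (S : Setup k r u v) (hp2 : 2 < p) {c f : LaurentSeries k} {A B : ℤ}
    (hc : ordGe (lsDeriv c) A) (hf : ordGe f B) :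
    ordGe (SS r v p (c * f) - v c * SS r v p f -
      v ((2 : LaurentSeries k)⁻¹ * (lsDeriv c * f)) * dd k r ^ 2) (A + B + 2 + 3 * r) := by
  have h1 : SS r v p (c * f) - v c * SS r v p f = ∑ i ∈ Finset.range (p - 1),
      v (((i + 1).factorial : LaurentSeries k)⁻¹ * (DD^[i] (c * f) - c * DD^[i] f)) *
        dd k r ^ (i + 1) := by
    rw [SS_apply, SS_apply, Finset.mul_sum, ← Finset.sum_sub_distrib]
    refine Finset.sum_congr rfl fun i _ => ?_
    simp only [map_mul, map_sub]
    ring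
  obtain ⟨q, hq⟩ : ∃ q, p - 1 = 2 + q := ⟨p - 3, by omega⟩
  rw [h1, hq, Finset.sum_range_add]
  have h2 : ∑ i ∈ Finset.range 2,
      v (((i + 1).factorial : LaurentSeries k)⁻¹ * (DD^[i] (c * f) - c * DD^[i] f)) *
        dd k r ^ (i + 1) = v ((2 : LaurentSeries k)⁻¹ * (lsDeriv c * f)) * dd k r ^ 2 := by
    rw [Finset.sum_range_succ, Finset.sum_range_one]
    have h3 : DD^[1] (c * f) - c * DD^[1] f = lsDeriv c * f := by
      rw [Function.iterate_one, D_leib, DD_apply c]; ring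
    rw [h3]
    simp
  rw [h2, add_sub_cancel_left]
  refine ordGe.sum fun i _ => ?_
  have h4 := ordGe_comm hc hf (2 + i)
  have h5 : ordGe (((2 + i + 1).factorial : LaurentSeries k)⁻¹ *
      (DD^[2 + i] (c * f) - c * DD^[2 + i] f)) (A + B + 2 - ((2 + i + 1 : ℕ) : ℤ)) :=
    (ordGe.inv_natCast _).mul' h4 (by push_cast; omega)
  refine (S.ordGe_term h5).mono ?_
  push_cast
  have : (0 : ℤ) ≤ (i : ℤ) * r := by positivity
  linarith

theorem order_nu {x : LaurentSeries k} (hx : x ≠ 0) (hx' : lsDeriv x ≠ 0) {ν : ℤ}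
    (h : (tt * lsDeriv x / x).order = ν) : (lsDeriv x).order = ν + x.order - 1 ∧ 0 ≤ ν := by
  rw [div_eq_mul_inv, HahnSeries.order_mul (mul_ne_zero tt_ne hx') (inv_ne_zero hx),
    HahnSeries.order_mul tt_ne hx', order_tt, order_inv' hx] at h
  have := (ordGe_lsDeriv (ordGe_self x)).resolve_left hx'
  omega

theorem ordGe_alpha {ι : Type*} (s : Finset ι) (x : ι → LaurentSeries k)
    (l : ι → ℕ) {n : ℤ} (h : ∀ i ∈ s, x i = 0 ∨ -n ≤ (p : ℤ) ^ (l i) * (x i).order) :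
    ordGe (∑ i ∈ s, x i ^ (p ^ (l i) - 1) * lsDeriv (x i)) (-n - 1) := by
  refine ordGe.sum fun i hi => ?_
  by_cases hx : x i = 0
  · have h0 : lsDeriv (0 : LaurentSeries k) = 0 := map_zero (DD (F := k))
    rw [hx, h0, mul_zero]
    exact ordGe_zero _
  · have h1 := (h i hi).resolve_left hx
    have h2 := ordGe_self (x i)
    refine (h2.pow _).mul' (ordGe_lsDeriv h2) ?_
    have : 1 ≤ p ^ l i := Nat.pos_of_ne_zero (pow_ne_zero _ hpF.out.ne_zero)
    push_cast [Nat.cast_sub this]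
    linarith

theorem Setup.analytic (S : Setup k r u v) (hp2 : 2 < p) {ι : Type*} (s : Finset ι)
    (x : ι → LaurentSeries k)
    (l : ι → ℕ) {n : ℤ} (h : ∀ i ∈ s, x i = 0 ∨ -n ≤ (p : ℤ) ^ (l i) * (x i).order)
    (b c α : LaurentSeries k) (hb : b ≠ 0) (hc : c ≠ 0)
    (hb' : lsDeriv b ≠ 0) (hc' : lsDeriv c ≠ 0)
    (νb νc : ℤ)
    (hνb : (tt * lsDeriv b / b).order = νb)
    (hνc : (tt * lsDeriv c / c).order = νc)
    (hα : α = ∑ i ∈ s, x i ^ (p ^ (l i) - 1) * lsDeriv (x i))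
    (hleg : α + c * lsDeriv b = 0)
    (hcond : νb + νc < ((p : ℤ) - 2) * (r : ℤ)) :
    ordGe (∑ i ∈ s, GG u v p (l i) (x i) + v c * (u b - v b) -
      v ((2 : LaurentSeries k)⁻¹ * tt ^ 2 * α * lsDeriv c / c) *
          (tt : LaurentSeries (RatFunc k)) ^ (2 * r) * θθ k ^ 2) (-n + νc + 2 * r + 1) ∧
    ordGe (v ((2 : LaurentSeries k)⁻¹ * tt ^ 2 * α * lsDeriv c / c) *
          (tt : LaurentSeries (RatFunc k)) ^ (2 * r) * θθ k ^ 2) (-n + νc + 2 * r) ∧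
    νc + 2 * r + 1 ≤ p * r := by
  obtain ⟨hob, hνb0⟩ := order_nu hb hb' hνb
  obtain ⟨hoc, hνc0⟩ := order_nu hc hc' hνc
  have hr := S.hr
  have hα1 : α = -(c * lsDeriv b) := eq_neg_of_add_eq_zero_left hleg
  have hmain : v ((2 : LaurentSeries k)⁻¹ * tt ^ 2 * α * lsDeriv c / c) *
          (tt : LaurentSeries (RatFunc k)) ^ (2 * r) * θθ k ^ 2 =
      -(v ((2 : LaurentSeries k)⁻¹ * (lsDeriv c * lsDeriv b)) * dd k r ^ 2) := by
    have h1 : (2 : LaurentSeries k)⁻¹ * tt ^ 2 * α * lsDeriv c / c =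
        -((2 : LaurentSeries k)⁻¹ * (lsDeriv c * lsDeriv b)) * tt ^ 2 := by
      rw [hα1, div_eq_mul_inv]
      linear_combination (-(2 : LaurentSeries k)⁻¹ * tt ^ 2 * lsDeriv b * lsDeriv c) *
        mul_inv_cancel₀ hc
    rw [h1, map_mul, map_neg, map_pow, S.v_tt]
    unfold dd
    ring
  have hαo : -n - 1 ≤ c.order + (lsDeriv b).order := by
    have h1 := ordGe_alpha p s x l h
    rw [← hα] at h1
    have h2 : α ≠ 0 := by rw [hα1]; exact neg_ne_zero.2 (mul_ne_zero hc hb')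
    have h3 := h1.resolve_left h2
    rw [hα1, HahnSeries.order_neg, HahnSeries.order_mul hc hb'] at h3
    exact h3
  have hpr : νb + νc + 2 * r + 1 ≤ p * r := by linarith
  refine ⟨?_, ?_, by linarith⟩
  · have hA := S.stepA p s x l h
    have hB := (S.ordGe_v (ordGe_self c)).mul (S.stepB p b)
    have hC := S.stepC p hp2 (ordGe_self (lsDeriv c)) (ordGe_self (lsDeriv b))
    rw [← hα, hα1, map_neg] at hA
    have hT := ((hA.mono (M := -n + νc + 2 * r + 1) (by linarith)).add
      (hB.mono (by linarith))).sub (hC.mono (by linarith))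
    rw [hmain]
    convert hT using 1
    ring
  · rw [hmain]
    have h2 : ordGe ((2 : LaurentSeries k)⁻¹) 0 := by
      have := ordGe.inv_natCast (F := k) 2
      exact_mod_cast this
    refine (((S.ordGe_v (h2.mul ((ordGe_self _).mul (ordGe_self _)))).mul'
      ((ordGe_dd k r).pow 2) ?_)).neg
    push_cast
    linarith

end assembly

section wittassembly

set_option linter.unusedSectionVars false

open Polynomial

theorem teich_add_V {p : ℕ} [hpF : Fact p.Prime] {A : Type*} [CommRing A] (B : WittVector p A) :
    B = WittVector.teichmuller p (B.coeff 0) + WittVector.verschiebung (WittVector.shift B 1) := by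
  conv_lhs => rw [← WittVector.init_add_tail B 1]
  congr 1
  · ext1 i
    rw [coeff_init']
    rcases i with _ | i
    · simp
    · rw [if_neg (by omega), WittVector.teichmuller_coeff_pos _ _ _ (by omega)]
  · ext1 i
    rw [coeff_tail']
    rcases i with _ | i
    · simp
    · rw [if_pos (by omega), WittVector.verschiebung_coeff_succ, WittVector.shift_coeff, add_comm]

theorem witt_decomp {p : ℕ} [hpF : Fact p.Prime] {A : Type*} [CommRing A] (B : WittVector p A)
    (N : ℕ) :
    B = ∑ i ∈ Finset.range N,
      WittVector.verschiebung^[i] (WittVector.teichmuller p (B.coeff i)) +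
      WittVector.verschiebung^[N] (WittVector.shift B N) := by
  induction N with
  | zero =>
    simp only [Finset.range_zero, Finset.sum_empty, zero_add, Function.iterate_zero, id]
    ext1 i; simp [WittVector.shift_coeff]
  | succ N ih =>
    rw [Finset.sum_range_succ]
    have h := teich_add_V (WittVector.shift B N)
    have h2 : WittVector.shift (WittVector.shift B N) 1 = WittVector.shift B (N + 1) := by
      ext1 i; simp only [WittVector.shift_coeff]; congr 1; ring
    rw [h2, WittVector.shift_coeff, add_zero] at h
    rw [Function.iterate_succ_apply, add_assoc, ← iterate_map_add, ← h]
    exact ih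

variable {k : Type*} [Field k] {r : ℕ} {u v : LaurentSeries k →+* LaurentSeries (RatFunc k)}
variable (p : ℕ) [hpF : Fact p.Prime]

theorem coeff_teich_uv (x : LaurentSeries k) (j : ℕ) :
    (WittVector.teichmuller p (u x) - WittVector.teichmuller p (v x)).coeff j = GG u v p j x := by
  by_cases hx : x = 0
  · rw [hx, GG_zero, map_zero u, map_zero v, sub_self, WittVector.zero_coeff]
  have hvx : v x ≠ 0 := (map_ne_zero v).2 hx
  have h1 : u x = v x * (1 + (u x / v x - 1)) := by field_simp; ring
  have h2 : WittVector.teichmuller p (u x) - WittVector.teichmuller p (v x) =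
      WittVector.teichmuller p (v x) * (WittVector.teichmuller p (1 + (u x / v x - 1)) -
        WittVector.teichmuller p 1) := by
    rw [mul_sub, ← map_mul, ← map_mul, mul_one, ← h1]
  rw [h2, teich_mul_coeff, coeff_teich_sub]
  rfl

theorem Setup.ordGe_GG [CharP k p] (S : Setup k r u v) (x : LaurentSeries k) (j : ℕ) :
    ordGe (GG u v p j x) (p ^ j * x.order + r) := by
  by_cases hx : x = 0
  · rw [hx, GG_zero]; exact ordGe_zero _
  have h1 := (S.ordGe_v (ordGe_self x)).pow (p ^ j)
  push_cast at h1
  refine h1.mul ?_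
  obtain ⟨h, hh⟩ := ss_dvd p j
  rw [hh, eval₂_mul, eval₂_X]
  have hz := Setup.z_bound p S hx
  refine hz.mul' (M := 0) ?_ (by omega)
  exact mem_OO.1 (eval₂_int_mem (OO _) (mem_OO.2 (hz.mono (by omega))) h)

theorem charP_ratFunc [CharP k p] : CharP (RatFunc k) p :=
  charP_of_injective_algebraMap (algebraMap k (RatFunc k)).injective p

theorem Setup.fil_term [CharP k p] (S : Setup k r u v) (x : LaurentSeries k) {m i : ℕ} (hi : i ≤ m)
    {n : ℤ} (h : x = 0 ∨ -n ≤ (p : ℤ) ^ (m - i) * x.order) :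
    FilW p m (n - p * r) (WittVector.verschiebung^[i] (WittVector.teichmuller p (u x) -
      WittVector.teichmuller p (v x)) -
      WittVector.verschiebung^[m] (WittVector.teichmuller p (GG u v p (m - i) x))) := by
  have := charP_ratFunc (k := k) p
  have hco : ∀ j, (WittVector.verschiebung^[i] (WittVector.teichmuller p (u x) -
      WittVector.teichmuller p (v x))).coeff (j + i) = GG u v p j x := by
    intro j
    rw [WittVector.iterate_verschiebung_coeff, coeff_teich_uv]
  have hm := hco (m - i)
  rw [Nat.sub_add_cancel hi] at hm
  rw [← hm]
  refine FilW_split fun i' hi' => ?_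
  by_cases hii : i' < i
  · left; exact WittVector.iterate_verschiebung_coeff_eq_zero _ hii
  obtain ⟨j, rfl⟩ := Nat.exists_eq_add_of_le' (not_lt.1 hii)
  rw [hco]
  by_cases hg : GG u v p j x = 0
  · left; exact hg
  right
  have hx : x ≠ 0 := by rintro rfl; exact hg (GG_zero p j)
  have h1 := h.resolve_left hx
  have h2 := (S.ordGe_GG p x j).resolve_left hg
  have h3 : (p : ℤ) ^ (m - i) = p ^ (m - (j + i)) * p ^ j := by
    rw [← pow_add]; congr 1; omega
  have hp1 : (1 : ℤ) ≤ p := by exact_mod_cast hpF.out.one_lt.le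
  have h4 : (p : ℤ) ≤ p ^ (m - (j + i)) := by
    calc (p : ℤ) = p ^ 1 := (pow_one _).symm
      _ ≤ _ := pow_le_pow_right₀ hp1 (by omega)
  have h5 : (p : ℤ) ^ (m - (j + i)) * (p ^ j * x.order + r) ≤
      p ^ (m - (j + i)) * (GG u v p j x).order := mul_le_mul_of_nonneg_left h2 (by positivity)
  have h6 : (p : ℤ) * r ≤ p ^ (m - (j + i)) * r := mul_le_mul_of_nonneg_right h4 (by positivity)
  rw [h3] at h1
  linarith

theorem FilW_main [CharP k p] (S : Setup k r u v) {m : ℕ} {n N : ℤ}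
    (A : WittVector p (LaurentSeries k))
    (hA : ∀ i ≤ m, A.coeff i = 0 ∨ -n ≤ (p : ℤ) ^ (m - i) * (A.coeff i).order)
    (w y : LaurentSeries (RatFunc k)) (hN : n - p * r ≤ N)
    (h : ordGe (∑ i ∈ Finset.range (m + 1), GG u v p (m - i) (A.coeff i) + w - y) (-N)) :
    FilW p m N (WittVector.map u A - WittVector.map v A +
      WittVector.verschiebung^[m] (WittVector.teichmuller p w) -
      WittVector.verschiebung^[m] (WittVector.teichmuller p y)) := by
  have := charP_ratFunc (k := k) p
  set T : ℕ → WittVector p (LaurentSeries (RatFunc k)) := fun i =>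
    WittVector.teichmuller p (u (A.coeff i)) - WittVector.teichmuller p (v (A.coeff i)) with hT
  set G : ℕ → WittVector p (LaurentSeries (RatFunc k)) := fun i =>
    WittVector.teichmuller p (GG u v p (m - i) (A.coeff i)) with hG
  have hu := witt_decomp (WittVector.map u A) (m + 1)
  have hv := witt_decomp (WittVector.map v A) (m + 1)
  simp only [WittVector.map_coeff] at hu hv
  have hsum : WittVector.map u A - WittVector.map v A =
      ∑ i ∈ Finset.range (m + 1), WittVector.verschiebung^[i] (T i) +
      WittVector.verschiebung^[m + 1] (WittVector.shift (WittVector.map u A) (m + 1) -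
        WittVector.shift (WittVector.map v A) (m + 1)) := by
    conv_lhs => rw [hu, hv]
    simp only [hT, iterate_map_sub, Finset.sum_sub_distrib]
    abel
  have h1 : FilW p m N (∑ i ∈ Finset.range (m + 1),
      (WittVector.verschiebung^[i] (T i) - WittVector.verschiebung^[m] (G i))) := by
    refine FilW.sum fun i hi => ?_
    have hi' : i ≤ m := by simp at hi; omega
    exact (S.fil_term p (A.coeff i) hi' (hA i hi')).mono hN
  have h2 : FilW p m N (WittVector.verschiebung^[m] (∑ i ∈ Finset.range (m + 1), G i +
      WittVector.teichmuller p w - WittVector.teichmuller p y)) := by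
    refine FilW_V ?_
    have h3 : (WittVector.constantCoeff : WittVector p (LaurentSeries (RatFunc k)) →+* _)
        (∑ i ∈ Finset.range (m + 1), G i +
      WittVector.teichmuller p w - WittVector.teichmuller p y) =
      ∑ i ∈ Finset.range (m + 1), GG u v p (m - i) (A.coeff i) + w - y := by
      rw [map_sub, map_add, map_sum]
      simp [hG, WittVector.constantCoeff]
    have h4 : (∑ i ∈ Finset.range (m + 1), G i +
      WittVector.teichmuller p w - WittVector.teichmuller p y).coeff 0 = _ := h3
    rw [h4]; exact h
  have h3 : FilW p m N (WittVector.verschiebung^[m + 1]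
      (WittVector.shift (WittVector.map u A) (m + 1) -
        WittVector.shift (WittVector.map v A) (m + 1))) :=
    FilW_of_zero fun i hi => WittVector.iterate_verschiebung_coeff_eq_zero _ (by omega)
  have h4 : ∀ (s : Finset ℕ), WittVector.verschiebung^[m] (∑ i ∈ s, G i) =
      ∑ i ∈ s, WittVector.verschiebung^[m] (G i) := by
    intro s
    induction s using Finset.induction_on with
    | empty => simp [iterate_map_zero]
    | insert a s ha ih => rw [Finset.sum_insert ha, Finset.sum_insert ha, iterate_map_add, ih]
  have h5 := (h1.add h2).add h3
  convert h5 using 1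
  rw [hsum, iterate_map_sub, iterate_map_sub, iterate_map_add, h4, Finset.sum_sub_distrib]
  abel

theorem mapTW_eq {K L : Type*} [CommRing K] [CommRing L] (f : K →+* L) {m : ℕ}
    (a : TruncatedWittVector p (m + 1) K) :
    mapTW p f a = WittVector.truncate (m + 1) (WittVector.map f a.out) := by
  ext i
  rw [WittVector.coeff_truncate, WittVector.map_coeff, TruncatedWittVector.coeff_out]
  simp [mapTW]

theorem Vm_eq {L : Type*} [CommRing L] {m : ℕ} (z : L) :
    (Vm p z : TruncatedWittVector p (m + 1) L) =
      WittVector.truncate (m + 1) (WittVector.verschiebung^[m] (WittVector.teichmuller p z)) := by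
  ext i
  rw [WittVector.coeff_truncate]
  unfold Vm
  rw [TruncatedWittVector.coeff_mk]
  split_ifs with h
  · have := WittVector.iterate_verschiebung_coeff (WittVector.teichmuller p z) m 0
    rw [zero_add] at this
    rw [h, this, WittVector.teichmuller_coeff_zero]
  · rw [WittVector.iterate_verschiebung_coeff_eq_zero _ (by omega)]

theorem inFil_truncate {N : ℤ} {m : ℕ} {A : WittVector p (LaurentSeries F)} (h : FilW p m N A) :
    inFil p N (WittVector.truncate (m + 1) A) := by
  intro i
  rw [WittVector.coeff_truncate]
  exact h i (by omega)

end wittassembly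

/-- Let `a ∈ fil_n W_{m+1}(K)`, `α = α(a)`, and let `b, c ∈ K^×`
with `b' ≠ 0`, `c' ≠ 0`; set `ν(b) = ord(t·b'/b)`, `ν(c) = ord(t·c'/c)`.
Assume `α + c·b' = 0` and `ν(b) + ν(c) < (p−2)·r`. Then
`E = W_{m+1}(u)(a) − W_{m+1}(v)(a) + V^m(v(c)·(u(b) − v(b)))` lies in
`fil_{n−ν(c)−2r} W_{m+1}(L)`, and
`E − V^m(v((1/2)·t²·α·c'/c)·t^{2r}·θ²)` lies in `fil_{n−ν(c)−2r−1} W_{m+1}(L)`. -/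
theorem statement8 (p : ℕ) [Fact p.Prime] (hp2 : 2 < p)
    (k : Type*) [Field k] [PerfectField k] [CharP k p]
    (r : ℕ) (hr : 1 ≤ r)
    (u v : LaurentSeries k →+* LaurentSeries (RatFunc k))
    (hv : ∀ (x : LaurentSeries k) (j : ℤ),
      (v x).coeff j = algebraMap k (RatFunc k) (x.coeff j))
    (hu_alg : ∀ c : k,
      u (HahnSeries.single 0 c) = HahnSeries.single 0 (algebraMap k (RatFunc k) c))
    (hu_t : u tt = tt * (1 + tt ^ r * θθ k))
    (hu_cont : ∀ N : ℤ, ∃ M : ℤ, ∀ x : LaurentSeries k, ordGe x M → ordGe (u x) N)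
    (m : ℕ) (n : ℤ)
    (a : TruncatedWittVector p (m + 1) (LaurentSeries k))
    (ha : inFil p n a)
    (b c : LaurentSeries k) (hb : b ≠ 0) (hc : c ≠ 0)
    (hb' : lsDeriv b ≠ 0) (hc' : lsDeriv c ≠ 0)
    (νb νc : ℤ)
    (hνb : (tt * lsDeriv b / b).order = νb)
    (hνc : (tt * lsDeriv c / c).order = νc)
    (hleg : alphaW p a + c * lsDeriv b = 0)
    (hcond : νb + νc < ((p : ℤ) - 2) * (r : ℤ)) :
    inFil p (n - νc - 2 * r)
      (mapTW p u a - mapTW p v a + Vm p (v c * (u b - v b))) ∧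
    inFil p (n - νc - 2 * r - 1)
      (mapTW p u a - mapTW p v a + Vm p (v c * (u b - v b)) -
        Vm p (v ((2 : LaurentSeries k)⁻¹ * tt ^ 2 * alphaW p a * lsDeriv c / c) *
          (tt : LaurentSeries (RatFunc k)) ^ (2 * r) * θθ k ^ 2)) := by
  have S : Setup k r u v := ⟨hr, hv, hu_alg, hu_t, hu_cont⟩
  have hLF : CharP (RatFunc k) p := charP_ratFunc p
  have hout : ∀ i : Fin (m + 1), a.out.coeff i = a.coeff i := fun i =>
    TruncatedWittVector.coeff_out a i
  have hA : ∀ i ≤ m, a.out.coeff i = 0 ∨ -n ≤ (p : ℤ) ^ (m - i) * (a.out.coeff i).order := by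
    intro i hi
    have h1 := ha ⟨i, by omega⟩
    rw [← hout] at h1
    exact h1
  have hα : alphaW p a = ∑ i ∈ Finset.range (m + 1),
      a.out.coeff i ^ (p ^ (m - i) - 1) * lsDeriv (a.out.coeff i) := by
    unfold alphaW
    rw [← Fin.sum_univ_eq_sum_range
      (fun i => a.out.coeff i ^ (p ^ (m - i) - 1) * lsDeriv (a.out.coeff i))]
    refine Finset.sum_congr rfl fun i _ => ?_
    rw [hout]
  obtain ⟨h1, h2, h3⟩ := S.analytic p hp2 (Finset.range (m + 1)) (fun i => a.out.coeff i)
    (fun i => m - i) (n := n) (fun i hi => hA i (by simp at hi; omega)) b c (alphaW p a) hb hc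
    hb' hc' νb νc hνb hνc hα hleg hcond
  have hF := FilW_main p S (m := m) (n := n) (N := n - νc - 2 * r - 1) a.out hA
    (v c * (u b - v b)) _ (by linarith) (h1.mono (by linarith))
  rw [mapTW_eq, mapTW_eq, Vm_eq, Vm_eq, ← map_sub, ← map_add, ← map_sub]
  refine ⟨inFil_truncate p ?_, inFil_truncate p hF⟩
  have hV := FilW_V (p := p) (m := m) (N := n - νc - 2 * r) (B := WittVector.teichmuller p
    (v ((2 : LaurentSeries k)⁻¹ * tt ^ 2 * alphaW p a * lsDeriv c / c) *
          (tt : LaurentSeries (RatFunc k)) ^ (2 * r) * θθ k ^ 2))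
    (by rw [WittVector.teichmuller_coeff_zero]; exact h2.mono (by linarith))
  have hS := (hF.mono (M := n - νc - 2 * r) (by linarith)).add hV
  rw [sub_add_cancel] at hS
  exact hS

end LFT
end
end

section
/- Let α, b, c ∈ K be nonzero with b' ≠ 0 and c' ≠ 0. Put n = −ord(t·α), ν(b) = ord(t·b'/b) and ν(c) = ord(t·c'/c). Assume 2·ord(α + c·b') ≥ −n + ν(c), 2·ν(b) + p·ν(c) < (p−2)·n, and that n − ν(c) is even. Then the element (1/2)·t^{n+2−ν(c)}·α·c'/c of K has ord equal to 0, so it lies in k[[t]] with nonzero constant coefficient γ ∈ k^×; and −c'/(2·b')·γ^{−1} is a square in K^×. -/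
/-!
Setting: `p > 2` a prime, `k` a perfect field of characteristic `p`,
`K = k((t))` the field of formal Laurent series, `ord` the `t`-adic valuation
(with `ord 0 = +∞`, encoded below via the predicate `ordGe`),
`L = k(θ)((t))` with `k(θ) = RatFunc k`.
-/

noncomputable section

namespace LFT

variable {F : Type*} [Field F]

theorem aux_order_div {F : Type*} [Field F] {x y : LaurentSeries F} (hx : x ≠ 0) (hy : y ≠ 0) :
    (x / y).order = x.order - y.order := by
  have h : (x / y * y).order = (x / y).order + y.order :=
    HahnSeries.order_mul (div_ne_zero hx hy) hy
  rw [div_mul_cancel₀ x hy] at h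
  omega

theorem aux_coeff_neg {F : Type*} [Field F] {x : LaurentSeries F} {i : ℤ} (h : i < x.order) :
    x.coeff i = 0 := HahnSeries.coeff_eq_zero_of_lt_order h

theorem aux_sq {F : Type*} [Field F] (h2 : (2 : F) ≠ 0) (x : LaurentSeries F)
    (h : ∀ i < 0, x.coeff i = 0) (h0 : x.coeff 0 = 1) :
    ∃ s : LaurentSeries F, s ≠ 0 ∧ s ^ 2 = x := by
  have hx : x ≠ 0 := by rintro rfl; simp at h0
  set f : PowerSeries F := PowerSeries.mk (fun n => x.coeff (n : ℤ)) with hf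
  have hfx : HahnSeries.ofPowerSeries ℤ F f = x := by
    ext i
    rw [PowerSeries.coeff_coe]
    split_ifs with hi
    · exact (h i hi).symm
    · rw [hf, PowerSeries.coeff_mk]
      congr 1; omega
  have H := HenselianRing.is_henselian (R := PowerSeries F) (I := Ideal.span {PowerSeries.X})
    (Polynomial.X ^ 2 - Polynomial.C f) (Polynomial.monic_X_pow_sub_C f two_ne_zero) 1
    (by
      rw [Ideal.mem_span_singleton, PowerSeries.X_dvd_iff]
      simp [hf, h0])
    (by
      apply IsUnit.map
      rw [PowerSeries.isUnit_iff_constantCoeff]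
      simp
      rw [one_add_one_eq_two]
      exact h2)
  obtain ⟨a, ha, -⟩ := H
  have ha2 : a ^ 2 = f := by
    simpa [Polynomial.IsRoot, sub_eq_zero] using ha
  have : (HahnSeries.ofPowerSeries ℤ F a) ^ 2 = x := by
    rw [← map_pow, ha2, hfx]
  refine ⟨_, ?_, this⟩
  intro h'
  rw [h'] at this
  apply hx
  rw [← this]; simp

theorem aux_deriv {F : Type*} [Field F] {x : LaurentSeries F} (hx : x ≠ 0)
    (hx' : lsDeriv x ≠ 0) : 0 ≤ (tt * lsDeriv x / x).order := by
  have ht : (tt : LaurentSeries F) ≠ 0 := by simp [tt]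
  rw [aux_order_div (mul_ne_zero ht hx') hx, HahnSeries.order_mul ht hx']
  have h1 : (tt : LaurentSeries F).order = 1 := HahnSeries.order_single one_ne_zero
  have h2 : x.order - 1 ≤ (lsDeriv x).order := by
    rw [HahnSeries.le_order_iff_forall hx']
    intro j hj
    change (j + 1) • x.coeff (j + 1) = 0
    rw [aux_coeff_neg (by omega), smul_zero]
  omega

theorem aux_order_zpow {F : Type*} [Field F] (m : ℤ) :
    ((tt : LaurentSeries F) ^ m) = HahnSeries.single m 1 := by
  exact (RatFunc.single_zpow m).symm

/-- Let `α, b, c ∈ K^×` with `b' ≠ 0`, `c' ≠ 0`. Put `n = −ord(t·α)`,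
`ν(b) = ord(t·b'/b)`, `ν(c) = ord(t·c'/c)`. Assume `2·ord(α + c·b') ≥ −n + ν(c)`
(with `ord 0 = +∞`), `2·ν(b) + p·ν(c) < (p−2)·n`, and `n − ν(c)` even. Then
`(1/2)·t^{n+2−ν(c)}·α·c'/c` has `ord = 0`, with nonzero constant coefficient `γ ∈ k^×`;
and `−c'/(2·b')·γ^{−1}` is a square in `K^×`. -/
theorem statement10 (p : ℕ) (hp : p.Prime) (hp2 : 2 < p)
    (k : Type*) [Field k] [PerfectField k] [CharP k p]
    (α b c : LaurentSeries k) (hα : α ≠ 0) (hb : b ≠ 0) (hc : c ≠ 0)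
    (hb' : lsDeriv b ≠ 0) (hc' : lsDeriv c ≠ 0)
    (n νb νc : ℤ)
    (hn : (tt * α).order = -n)
    (hνb : (tt * lsDeriv b / b).order = νb)
    (hνc : (tt * lsDeriv c / c).order = νc)
    (h1 : α + c * lsDeriv b = 0 ∨ -n + νc ≤ 2 * (α + c * lsDeriv b).order)
    (h2 : 2 * νb + (p : ℤ) * νc < ((p : ℤ) - 2) * n)
    (h3 : Even (n - νc)) :
    (2 : LaurentSeries k)⁻¹ * tt ^ (n + 2 - νc) * α * lsDeriv c / c ≠ 0 ∧
    ((2 : LaurentSeries k)⁻¹ * tt ^ (n + 2 - νc) * α * lsDeriv c / c).order = 0 ∧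
    ((2 : LaurentSeries k)⁻¹ * tt ^ (n + 2 - νc) * α * lsDeriv c / c).coeff 0 ≠ 0 ∧
    ∃ s : LaurentSeries k, s ≠ 0 ∧
      -lsDeriv c / (2 * lsDeriv b) *
        (HahnSeries.single (0 : ℤ)
          (((2 : LaurentSeries k)⁻¹ * tt ^ (n + 2 - νc) * α * lsDeriv c / c).coeff 0))⁻¹
        = s ^ 2 := by
  have ht : (tt : LaurentSeries k) ≠ 0 := by simp [tt]
  have htord : (tt : LaurentSeries k).order = 1 := HahnSeries.order_single one_ne_zero
  have h2k : (2 : k) ≠ 0 := by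
    intro h
    have : ((2 : ℕ) : k) = 0 := by exact_mod_cast h
    rw [CharP.cast_eq_zero_iff k p] at this
    exact absurd (Nat.le_of_dvd two_pos this) (by omega)
  have h2C : (2 : LaurentSeries k) = HahnSeries.single 0 2 := by
    have : (HahnSeries.C (2 : k) : LaurentSeries k) = 2 := map_ofNat _ 2
    exact this.symm
  have h2K : (2 : LaurentSeries k) ≠ 0 := by
    rw [h2C]; simpa using h2k
  have h2ord : (2 : LaurentSeries k).order = 0 := by
    rw [h2C]; exact HahnSeries.order_single h2k
  have hνb0 : 0 ≤ νb := hνb ▸ aux_deriv hb hb'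
  have hνc0 : 0 ≤ νc := hνc ▸ aux_deriv hc hc'
  have hp3 : (3 : ℤ) ≤ p := by exact_mod_cast hp2
  have hn0 : 0 < n := by
    by_contra hcon
    push Not at hcon
    nlinarith [mul_nonneg (by linarith : (0 : ℤ) ≤ p) hνc0]
  rw [HahnSeries.order_mul ht hα, htord] at hn
  rw [aux_order_div (mul_ne_zero ht hc') hc, HahnSeries.order_mul ht hc', htord] at hνc
  set u := (2 : LaurentSeries k)⁻¹ * tt ^ (n + 2 - νc) * α * lsDeriv c / c with hu
  have hz : (tt : LaurentSeries k) ^ (n + 2 - νc) ≠ 0 := zpow_ne_zero _ ht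
  have hzord : ((tt : LaurentSeries k) ^ (n + 2 - νc)).order = n + 2 - νc := by
    rw [aux_order_zpow]; exact HahnSeries.order_single one_ne_zero
  have h2i : (2 : LaurentSeries k)⁻¹ ≠ 0 := inv_ne_zero h2K
  have h2iord : ((2 : LaurentSeries k)⁻¹).order = 0 := by
    rw [← one_div, aux_order_div one_ne_zero h2K, h2ord]; simp
  have hu0 : u ≠ 0 := by
    rw [hu]; exact div_ne_zero (mul_ne_zero (mul_ne_zero (mul_ne_zero h2i hz) hα) hc') hc
  have huord : u.order = 0 := by
    rw [hu, aux_order_div (mul_ne_zero (mul_ne_zero (mul_ne_zero h2i hz) hα) hc') hc,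
      HahnSeries.order_mul (mul_ne_zero (mul_ne_zero h2i hz) hα) hc',
      HahnSeries.order_mul (mul_ne_zero h2i hz) hα,
      HahnSeries.order_mul h2i hz, hzord, h2iord]
    omega
  have hγ : u.coeff 0 ≠ 0 := by
    have := HahnSeries.coeff_order_eq_zero.not.2 hu0
    rwa [huord] at this
  refine ⟨hu0, huord, hγ, ?_⟩
  set γ := u.coeff 0 with hγdef
  have hG0 : (HahnSeries.single (0 : ℤ) γ : LaurentSeries k) ≠ 0 := by simpa using hγ
  have hGinv : (HahnSeries.single (0 : ℤ) γ : LaurentSeries k)⁻¹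
      = HahnSeries.single (0 : ℤ) γ⁻¹ := by
    apply inv_eq_of_mul_eq_one_right
    simp [hγ]
  -- first one-unit
  obtain ⟨s₁, hs₁, hs₁u⟩ := aux_sq h2k (HahnSeries.single (0 : ℤ) γ⁻¹ * u)
    (by
      intro i hi
      rw [HahnSeries.coeff_single_zero_mul, aux_coeff_neg (by omega), mul_zero])
    (by
      rw [HahnSeries.coeff_single_zero_mul, ← hγdef, inv_mul_cancel₀ hγ])
  -- second one-unit
  set e := α + c * lsDeriv b with he
  have hecoeff : ∀ i ≤ 0, (e / α).coeff i = 0 := by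
    intro i hi
    rcases eq_or_ne e 0 with h | h
    · simp [h]
    · have h1' := h1.resolve_left h
      apply aux_coeff_neg
      rw [aux_order_div h hα]
      omega
  obtain ⟨s₂, hs₂, hs₂u⟩ := aux_sq h2k (1 - e / α)
    (by
      intro i hi
      rw [HahnSeries.coeff_sub, hecoeff i hi.le, HahnSeries.coeff_one, if_neg hi.ne, sub_zero])
    (by
      rw [HahnSeries.coeff_sub, hecoeff 0 le_rfl, HahnSeries.coeff_one, if_pos rfl, sub_zero])
  obtain ⟨r, hr⟩ := h3
  have hcb : lsDeriv b = -(α * s₂ ^ 2) / c := by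
    rw [hs₂u, he]; field_simp; ring
  have hzr : (tt : LaurentSeries k) ^ (n + 2 - νc) = (tt ^ (r + 1)) ^ 2 := by
    rw [← zpow_natCast, ← zpow_mul]; congr 1; push_cast; omega
  have hzr0 : (tt : LaurentSeries k) ^ (r + 1) ≠ 0 := zpow_ne_zero _ ht
  refine ⟨s₁ * c / (s₂ * α * tt ^ (r + 1)), ?_, ?_⟩
  · exact div_ne_zero (mul_ne_zero hs₁ hc) (mul_ne_zero (mul_ne_zero hs₂ hα) hzr0)
  · rw [hGinv, div_pow, mul_pow, hs₁u, hcb, hu, hzr]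
    field_simp

end LFT
end
end
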